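/- arXiv:1609.00412 — 3 statements merged into one kernel-verified Lean document; each statement's English description precedes it below -/
import Mathlib

section
/- (Diffusion limit of the transport equation.) Let T > 0 and let a : ℝ² → ℝ be smooth, 1-periodic in both variables, with 0 < λ ≤ a(x) ≤ Λ for all x. Let ρ₀ : ℝ² → ℝ be smooth and 1-periodic in both variables, and let ρ : [0,T] × ℝ² → ℝ be a C¹ in time, C² in space, spatially 1-periodic solution of the heat equation ∂_t ρ = (1/2) ∇_x · (a ∇_x ρ) with ρ(0,·) = ρ₀. Then there exists a constant C > 0, independent of ε, such that for every ε ∈ (0,1] and every C¹ function f : [0,T] × ℝ² × ℝ → ℝ that is 1-periodic in both spatial variables, 2π-periodic in ξ, solves the scaled transport equation ε a(x) ∂_t f + a(x) cos ξ ∂_x f + a(x) sin ξ ∂_y f = (1/ε) (⟨f⟩_ξ − f) on [0,T] × ℝ² × ℝ, and has velocity-independent initial data f(0,x,ξ) = ρ₀(x), one has for all t ∈ [0,T]: ( ∫_{[0,1]²} (1/(2π)) ∫_{−π}^{π} |f(t,x,ξ) − ρ(t,x)|² dξ dx )^{1/2} ≤ C ε. -/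
open MeasureTheory Real

/-- One spatial period times one velocity period. -/
def phaseBox : Set (ℝ × ℝ × ℝ) :=
  Set.Icc 0 1 ×ˢ Set.Icc 0 1 ×ˢ Set.Icc (-π) π

lemma isCompact_phaseBox : IsCompact phaseBox :=
  isCompact_Icc.prod (isCompact_Icc.prod isCompact_Icc)

lemma measurableSet_phaseBox : MeasurableSet phaseBox :=
  isCompact_phaseBox.measurableSet

lemma Continuous.integrableOn_phaseBox {F : ℝ × ℝ × ℝ → ℝ} (hF : Continuous F) :
    IntegrableOn F phaseBox :=
  hF.continuousOn.integrableOn_compact isCompact_phaseBox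

lemma volume_restrict_phaseBox :
    (volume : Measure (ℝ × ℝ × ℝ)).restrict phaseBox =
      (volume.restrict (Set.Icc (0 : ℝ) 1)).prod
        ((volume.restrict (Set.Icc (0 : ℝ) 1)).prod (volume.restrict (Set.Icc (-π) π))) := by
  rw [Measure.prod_restrict, Measure.prod_restrict]
  rfl

lemma volume_real_phaseBox : (volume : Measure (ℝ × ℝ × ℝ)).real phaseBox = 2 * π := by
  have h : (volume : Measure (ℝ × ℝ × ℝ)) phaseBox = ENNReal.ofReal (2 * π) := by
    change ((volume : Measure ℝ).prod ((volume : Measure ℝ).prod (volume : Measure ℝ))) phaseBox = _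
    rw [phaseBox, Measure.prod_prod, Measure.prod_prod]
    simp only [Real.volume_Icc]
    rw [← ENNReal.ofReal_mul (by norm_num), ← ENNReal.ofReal_mul (by norm_num)]
    ring_nf
  rw [Measure.real, h, ENNReal.toReal_ofReal (by positivity)]

/-- Fubini on the phase box, velocity integral innermost. -/
lemma integral_phaseBox_eq {F : ℝ × ℝ × ℝ → ℝ} (hF : Continuous F) :
    ∫ p in phaseBox, F p =
      ∫ x in Set.Icc (0 : ℝ) 1, ∫ y in Set.Icc (0 : ℝ) 1, ∫ ξ in Set.Ioc (-π) π, F (x, y, ξ) := by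
  have h := hF.integrableOn_phaseBox
  rw [IntegrableOn, volume_restrict_phaseBox] at h
  rw [volume_restrict_phaseBox, integral_prod _ h]
  refine integral_congr_ae (Filter.Eventually.of_forall fun x => ?_)
  have hx : Integrable (fun q : ℝ × ℝ => F (x, q))
      ((volume.restrict (Set.Icc (0 : ℝ) 1)).prod (volume.restrict (Set.Icc (-π) π))) := by
    rw [Measure.prod_restrict]
    exact (by fun_prop : Continuous fun q : ℝ × ℝ => F (x, q)).continuousOn.integrableOn_compact
      (isCompact_Icc.prod isCompact_Icc)
  simp only
  rw [integral_prod _ hx]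
  exact integral_congr_ae (Filter.Eventually.of_forall fun y => integral_Icc_eq_integral_Ioc)

/-- `G` is spatially periodic with continuous partial derivatives `Gx`, `Gy`. -/
structure HasSpatialGrad (G Gx Gy : ℝ × ℝ × ℝ → ℝ) : Prop where
  cont : Continuous G
  cont_x : Continuous Gx
  cont_y : Continuous Gy
  deriv_x : ∀ x y ξ, HasDerivAt (fun s => G (s, y, ξ)) (Gx (x, y, ξ)) x
  deriv_y : ∀ x y ξ, HasDerivAt (fun s => G (x, s, ξ)) (Gy (x, y, ξ)) y
  per_x : ∀ x y ξ, G (x + 1, y, ξ) = G (x, y, ξ)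
  per_y : ∀ x y ξ, G (x, y + 1, ξ) = G (x, y, ξ)

lemma integral_phaseBox_eq_x {F : ℝ × ℝ × ℝ → ℝ} (hF : Continuous F) :
    ∫ p in phaseBox, F p =
      ∫ q in Set.Icc (0 : ℝ) 1 ×ˢ Set.Icc (-π) π, ∫ x in (0 : ℝ)..1, F (x, q) := by
  have h := hF.integrableOn_phaseBox
  rw [IntegrableOn, volume_restrict_phaseBox] at h
  rw [volume_restrict_phaseBox, integral_prod_symm _ h, Measure.prod_restrict]
  simp only [intervalIntegral.integral_of_le zero_le_one, integral_Icc_eq_integral_Ioc]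
  rfl

namespace HasSpatialGrad

variable {G Gx Gy H Hx Hy : ℝ × ℝ × ℝ → ℝ}

lemma integral_x (h : HasSpatialGrad G Gx Gy) : ∫ p in phaseBox, Gx p = 0 := by
  rw [integral_phaseBox_eq_x h.cont_x]
  have key : ∀ q : ℝ × ℝ, ∫ x in (0 : ℝ)..1, Gx (x, q) = 0 := by
    rintro ⟨y, ξ⟩
    have hc := h.cont_x
    rw [intervalIntegral.integral_eq_sub_of_hasDerivAt (fun x _ => h.deriv_x x y ξ)
      (Continuous.intervalIntegrable (by fun_prop) _ _)]
    simpa [sub_eq_zero] using h.per_x 0 y ξ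
  simp [key]

lemma integral_y (h : HasSpatialGrad G Gx Gy) : ∫ p in phaseBox, Gy p = 0 := by
  have hc := h.cont_y
  have hi := h.cont_y.integrableOn_phaseBox
  rw [IntegrableOn, volume_restrict_phaseBox] at hi
  rw [volume_restrict_phaseBox, integral_prod _ hi]
  have key : ∀ x : ℝ, ∫ q, Gy (x, q) ∂((volume.restrict (Set.Icc (0 : ℝ) 1)).prod
      (volume.restrict (Set.Icc (-π) π))) = 0 := by
    intro x
    have hx : Integrable (fun q : ℝ × ℝ => Gy (x, q))
        ((volume.restrict (Set.Icc (0 : ℝ) 1)).prod (volume.restrict (Set.Icc (-π) π))) := by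
      rw [Measure.prod_restrict]
      exact (by fun_prop : Continuous fun q : ℝ × ℝ => Gy (x, q)).continuousOn.integrableOn_compact
        (isCompact_Icc.prod isCompact_Icc)
    rw [integral_prod_symm _ hx]
    have : ∀ ξ : ℝ, ∫ y in Set.Icc (0 : ℝ) 1, Gy (x, y, ξ) = 0 := by
      intro ξ
      rw [integral_Icc_eq_integral_Ioc, ← intervalIntegral.integral_of_le zero_le_one,
        intervalIntegral.integral_eq_sub_of_hasDerivAt (fun y _ => h.deriv_y x y ξ)
          (Continuous.intervalIntegrable (by fun_prop) _ _)]
      simpa [sub_eq_zero] using h.per_y x 0 ξ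
    simp [this]
  simp [key]

lemma per_x_y (h : HasSpatialGrad G Gx Gy) (x y ξ : ℝ) : Gy (x + 1, y, ξ) = Gy (x, y, ξ) := by
  have h1 := h.deriv_y (x + 1) y ξ
  simp only [h.per_x] at h1
  exact h1.unique (h.deriv_y x y ξ)

lemma mul (hG : HasSpatialGrad G Gx Gy) (hH : HasSpatialGrad H Hx Hy) :
    HasSpatialGrad (fun p => G p * H p) (fun p => Gx p * H p + G p * Hx p)
      (fun p => Gy p * H p + G p * Hy p) := by
  obtain ⟨h1, h2, h3, h4, h5, h6, h7⟩ := hG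
  obtain ⟨k1, k2, k3, k4, k5, k6, k7⟩ := hH
  exact ⟨by fun_prop, by fun_prop, by fun_prop, fun x y ξ => (h4 x y ξ).mul (k4 x y ξ),
    fun x y ξ => (h5 x y ξ).mul (k5 x y ξ), fun x y ξ => by simp only [h6, k6],
    fun x y ξ => by simp only [h7, k7]⟩

lemma add (hG : HasSpatialGrad G Gx Gy) (hH : HasSpatialGrad H Hx Hy) :
    HasSpatialGrad (fun p => G p + H p) (fun p => Gx p + Hx p) (fun p => Gy p + Hy p) := by
  obtain ⟨h1, h2, h3, h4, h5, h6, h7⟩ := hG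
  obtain ⟨k1, k2, k3, k4, k5, k6, k7⟩ := hH
  exact ⟨by fun_prop, by fun_prop, by fun_prop, fun x y ξ => (h4 x y ξ).add (k4 x y ξ),
    fun x y ξ => (h5 x y ξ).add (k5 x y ξ), fun x y ξ => by simp only [h6, k6],
    fun x y ξ => by simp only [h7, k7]⟩

lemma of_velocity {c : ℝ → ℝ} (hc : Continuous c) :
    HasSpatialGrad (fun p => c p.2.2) (fun _ => 0) (fun _ => 0) :=
  ⟨by fun_prop, by fun_prop, by fun_prop, fun x _ ξ => hasDerivAt_const x (c ξ),
    fun _ y ξ => hasDerivAt_const y (c ξ), fun _ _ _ => rfl, fun _ _ _ => rfl⟩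

lemma shift_x (hG : HasSpatialGrad G Gx Gy) (c : ℝ) :
    HasSpatialGrad (fun p => G (p.1 + c, p.2)) (fun p => Gx (p.1 + c, p.2))
      (fun p => Gy (p.1 + c, p.2)) := by
  obtain ⟨h1, h2, h3, h4, h5, h6, h7⟩ := hG
  refine ⟨by fun_prop, by fun_prop, by fun_prop, fun x y ξ => ?_,
    fun x y ξ => h5 (x + c) y ξ, fun x y ξ => ?_, fun x y ξ => h7 (x + c) y ξ⟩
  · exact (h4 (x + c) y ξ).comp_add_const x c
  · rw [← h6 (x + c) y ξ]; simp only; ring_nf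

end HasSpatialGrad

/-- `B` is the free-transport derivative `cos ξ ∂ₓG + sin ξ ∂_yG` of the periodic function `G`. -/
def HasTransportDeriv (G B : ℝ × ℝ × ℝ → ℝ) : Prop :=
  ∃ Gx Gy, HasSpatialGrad G Gx Gy ∧ ∀ p, B p = cos p.2.2 * Gx p + sin p.2.2 * Gy p

namespace HasTransportDeriv

variable {G B H A : ℝ × ℝ × ℝ → ℝ}

lemma cont (h : HasTransportDeriv G B) : Continuous G := by
  obtain ⟨_, _, h, _⟩ := h; exact h.cont

lemma cont_deriv (h : HasTransportDeriv G B) : Continuous B := by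
  obtain ⟨Gx, Gy, h, hB⟩ := h
  have h1 := h.cont_x
  have h2 := h.cont_y
  rw [funext hB]; fun_prop

lemma mul (hG : HasTransportDeriv G B) (hH : HasTransportDeriv H A) :
    HasTransportDeriv (fun p => G p * H p) (fun p => B p * H p + G p * A p) := by
  obtain ⟨Gx, Gy, h, hB⟩ := hG
  obtain ⟨Hx, Hy, k, hA⟩ := hH
  exact ⟨_, _, h.mul k, fun p => by simp only [hB, hA]; ring⟩

lemma add (hG : HasTransportDeriv G B) (hH : HasTransportDeriv H A) :
    HasTransportDeriv (fun p => G p + H p) (fun p => B p + A p) := by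
  obtain ⟨Gx, Gy, h, hB⟩ := hG
  obtain ⟨Hx, Hy, k, hA⟩ := hH
  exact ⟨_, _, h.add k, fun p => by simp only [hB, hA]; ring⟩

lemma const_mul (c : ℝ) (hG : HasTransportDeriv G B) :
    HasTransportDeriv (fun p => c * G p) (fun p => c * B p) := by
  have h : HasTransportDeriv (fun _ => c) (fun _ => 0) :=
    ⟨_, _, HasSpatialGrad.of_velocity (c := fun _ => c) continuous_const, by simp⟩
  simpa using h.mul hG

lemma sub (hG : HasTransportDeriv G B) (hH : HasTransportDeriv H A) :
    HasTransportDeriv (fun p => G p - H p) (fun p => B p - A p) := by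
  simpa [sub_eq_add_neg] using hG.add (hH.const_mul (-1))

lemma integral_eq_zero (h : HasTransportDeriv G B) : ∫ p in phaseBox, B p = 0 := by
  obtain ⟨Gx, Gy, h, hB⟩ := h
  have h1 := ((HasSpatialGrad.of_velocity continuous_cos).mul h).integral_x
  have h2 := ((HasSpatialGrad.of_velocity continuous_sin).mul h).integral_y
  have c1 := h.cont_x
  have c2 := h.cont_y
  simp only [zero_mul, zero_add] at h1 h2
  rw [funext hB, integral_add (Continuous.integrableOn_phaseBox (by fun_prop))
    (Continuous.integrableOn_phaseBox (by fun_prop)), h1, h2, add_zero]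

end HasTransportDeriv

/-- The velocity average of `F` vanishes at every spatial point. -/
def VelocityMeanZero (F : ℝ × ℝ × ℝ → ℝ) : Prop :=
  ∀ x y, ∫ ξ in Set.Ioc (-π) π, F (x, y, ξ) = 0

lemma VelocityMeanZero.integral_mul_eq_zero {F : ℝ × ℝ × ℝ → ℝ} (h : VelocityMeanZero F)
    (hF : Continuous F) {φ : ℝ × ℝ → ℝ} (hφ : Continuous φ) :
    ∫ p in phaseBox, φ (p.1, p.2.1) * F p = 0 := by
  rw [integral_phaseBox_eq (by fun_prop)]
  simp only [integral_const_mul, h _ _, mul_zero, integral_zero]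

lemma VelocityMeanZero.sub {F G : ℝ × ℝ × ℝ → ℝ} (hF0 : VelocityMeanZero F) (hF : Continuous F)
    (hG : Continuous G) (hG0 : VelocityMeanZero G) : VelocityMeanZero fun p => F p - G p := by
  intro x y
  have h1 : IntegrableOn (fun ξ => F (x, y, ξ)) (Set.Ioc (-π) π) :=
    (by fun_prop : Continuous fun ξ => F (x, y, ξ)).integrableOn_Ioc
  have h2 : IntegrableOn (fun ξ => G (x, y, ξ)) (Set.Ioc (-π) π) :=
    (by fun_prop : Continuous fun ξ => G (x, y, ξ)).integrableOn_Ioc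
  simp only
  rw [integral_sub h1 h2, hF0, hG0, sub_zero]

lemma VelocityMeanZero.const_mul {F : ℝ × ℝ × ℝ → ℝ} (hF : VelocityMeanZero F) (c : ℝ) :
    VelocityMeanZero fun p => c * F p := by
  intro x y
  simp only [integral_const_mul, hF x y, mul_zero]

lemma velocityMeanZero_cos_add_sin (φ ψ : ℝ × ℝ → ℝ) :
    VelocityMeanZero fun p => cos p.2.2 * φ (p.1, p.2.1) + sin p.2.2 * ψ (p.1, p.2.1) := by
  intro x y
  rw [← intervalIntegral.integral_of_le (by linarith [pi_pos])]
  simp only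
  rw [intervalIntegral.integral_add (Continuous.intervalIntegrable (by fun_prop) _ _)
    (Continuous.intervalIntegrable (by fun_prop) _ _)]
  simp

lemma velocityMeanZero_quadratic (α β γ : ℝ × ℝ → ℝ) :
    VelocityMeanZero fun p => (cos p.2.2 ^ 2 - 1 / 2) * α (p.1, p.2.1) +
      (sin p.2.2 ^ 2 - 1 / 2) * β (p.1, p.2.1) + cos p.2.2 * sin p.2.2 * γ (p.1, p.2.1) := by
  intro x y
  rw [← intervalIntegral.integral_of_le (by linarith [pi_pos])]
  have h : ∀ ξ : ℝ, (cos ξ ^ 2 - 1 / 2) * α (x, y) + (sin ξ ^ 2 - 1 / 2) * β (x, y) +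
      cos ξ * sin ξ * γ (x, y) =
      (α (x, y) - β (x, y)) / 2 * cos (2 * ξ) + γ (x, y) / 2 * sin (2 * ξ) := by
    intro ξ
    rw [cos_two_mul, sin_two_mul, sin_sq]; ring
  simp only [h]
  rw [intervalIntegral.integral_add (Continuous.intervalIntegrable (by fun_prop) _ _)
    (Continuous.intervalIntegrable (by fun_prop) _ _)]
  simp

/-- Differentiation under the integral over the phase box. -/
lemma hasDerivAt_integral_phaseBox {F F' : ℝ × ℝ × ℝ × ℝ → ℝ}
    (hF : Continuous F) (hF' : Continuous F')
    (hd : ∀ t p, HasDerivAt (fun s => F (s, p)) (F' (t, p)) t) (t : ℝ) :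
    HasDerivAt (fun s => ∫ p in phaseBox, F (s, p)) (∫ p in phaseBox, F' (t, p)) t := by
  obtain ⟨M, hM⟩ := ((isCompact_Icc (a := t - 1) (b := t + 1)).prod
    isCompact_phaseBox).exists_bound_of_continuousOn hF'.continuousOn
  refine (hasDerivAt_integral_of_dominated_loc_of_deriv_le (F := fun s p => F (s, p))
    (F' := fun s p => F' (s, p)) (μ := volume.restrict phaseBox) (bound := fun _ => M)
    (Icc_mem_nhds (by linarith : t - 1 < t) (by linarith : t < t + 1)) ?_ ?_ ?_ ?_ ?_ ?_).2
  · exact Filter.Eventually.of_forall fun s => Continuous.aestronglyMeasurable (by fun_prop)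
  · exact Continuous.integrableOn_phaseBox (by fun_prop)
  · exact Continuous.aestronglyMeasurable (by fun_prop)
  · exact (ae_restrict_iff' measurableSet_phaseBox).2
      (Filter.Eventually.of_forall fun p hp s hs => hM (s, p) ⟨hs, hp⟩)
  · exact Continuous.integrableOn_phaseBox (by fun_prop)
  · exact Filter.Eventually.of_forall fun p s _ => hd s p

lemma integral_phaseBox_mono {F G : ℝ × ℝ × ℝ → ℝ} (hF : Continuous F) (hG : Continuous G)
    (h : ∀ p ∈ phaseBox, F p ≤ G p) : ∫ p in phaseBox, F p ≤ ∫ p in phaseBox, G p :=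
  setIntegral_mono_on hF.integrableOn_phaseBox hG.integrableOn_phaseBox measurableSet_phaseBox h

lemma integral_phaseBox_le {F : ℝ × ℝ × ℝ → ℝ} {M : ℝ} (hF : Continuous F)
    (h : ∀ p ∈ phaseBox, F p ≤ M) : ∫ p in phaseBox, F p ≤ 2 * π * M := by
  refine (integral_phaseBox_mono hF continuous_const h).trans_eq ?_
  rw [setIntegral_const, volume_real_phaseBox, smul_eq_mul]

lemma integral_phaseBox_shift_x {F : ℝ × ℝ × ℝ → ℝ} (hF : Continuous F)
    (hper : ∀ x y ξ, F (x + 1, y, ξ) = F (x, y, ξ)) (c : ℝ) :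
    ∫ p in phaseBox, F (p.1 + c, p.2) = ∫ p in phaseBox, F p := by
  rw [integral_phaseBox_eq_x hF, integral_phaseBox_eq_x (by fun_prop)]
  refine integral_congr_ae (Filter.Eventually.of_forall fun q => ?_)
  have hp : Function.Periodic (fun x => F (x, q)) 1 := fun x => hper x q.1 q.2
  have := hp.intervalIntegral_add_eq c 0
  simp only [intervalIntegral.integral_comp_add_right (fun x => F (x, q)) c]
  simpa [add_comm] using this

/-- The Jacobian determinant of two periodic functions integrates to zero. -/
lemma HasSpatialGrad.integral_jacobian {U Ux Uy V Vx Vy : ℝ × ℝ × ℝ → ℝ}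
    (hU : HasSpatialGrad U Ux Uy) (hV : HasSpatialGrad V Vx Vy) :
    ∫ p in phaseBox, Ux p * Vy p = ∫ p in phaseBox, Uy p * Vx p := by
  have cU := hU.cont
  have cUx := hU.cont_x
  have cUy := hU.cont_y
  have cV := hV.cont
  have cVx := hV.cont_x
  have cVy := hV.cont_y
  have key : ∀ c : ℝ, ∫ p in phaseBox, U (p.1 + c, p.2) * Vy p =
      -∫ p in phaseBox, Uy p * V (p.1 - c, p.2) := by
    intro c
    have h1 := ((hU.shift_x c).mul hV).integral_y
    rw [integral_add (Continuous.integrableOn_phaseBox (by fun_prop))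
      (Continuous.integrableOn_phaseBox (by fun_prop))] at h1
    have h2 := integral_phaseBox_shift_x (F := fun p => Uy p * V (p.1 - c, p.2)) (by fun_prop)
      (fun x y ξ => by
        simp only [hU.per_x_y]
        rw [← hV.per_x (x - c) y ξ]
        ring_nf) c
    simp only [add_sub_cancel_right] at h2
    linarith
  have d1 := hasDerivAt_integral_phaseBox
    (F := fun q => U (q.2.1 + q.1, q.2.2) * Vy q.2)
    (F' := fun q => Ux (q.2.1 + q.1, q.2.2) * Vy q.2)
    (by fun_prop) (by fun_prop)
    (fun t p => ((hU.deriv_x (p.1 + t) p.2.1 p.2.2).comp_const_add p.1 t).mul_const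
      (Vy p)) 0
  have d2 := hasDerivAt_integral_phaseBox
    (F := fun q => Uy q.2 * V (q.2.1 - q.1, q.2.2))
    (F' := fun q => Uy q.2 * (-Vx (q.2.1 - q.1, q.2.2)))
    (by fun_prop) (by fun_prop)
    (fun t p => ((hV.deriv_x (p.1 - t) p.2.1 p.2.2).comp_const_sub p.1 t).const_mul
      (Uy p)) 0
  simp only [key] at d1
  have := d1.unique d2.neg
  simpa [integral_neg] using this

/-- Energy identity for the error `f - r` of a kinetic solution at a fixed time. The right-hand
side contains the dissipation of the rescaled deviation `g / ε + W` from local equilibrium. -/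
lemma kinetic_energy_identity {ε : ℝ} (hε : 0 < ε) {a r φ ρt : ℝ × ℝ → ℝ}
    {f ft Df g Dr W B : ℝ × ℝ × ℝ → ℝ} (ha : Continuous a) (ha0 : ∀ q, 0 < a q)
    (hφ : Continuous φ) (hρt : Continuous ρt) (hft : Continuous ft) (hg : Continuous g)
    (hf : HasTransportDeriv f Df) (hr : HasTransportDeriv (fun p => r (p.1, p.2.1)) Dr)
    (hW : HasTransportDeriv W B) (hWa : ∀ p, W p = a (p.1, p.2.1) * Dr p)
    (hfg : ∀ p, f p = φ (p.1, p.2.1) + g p)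
    (heq : ∀ p, ε * a (p.1, p.2.1) * ft p + a (p.1, p.2.1) * Df p = -(ε⁻¹ * g p))
    (mg : VelocityMeanZero g) (mW : VelocityMeanZero W) (mDr : VelocityMeanZero Dr)
    (mB : VelocityMeanZero fun p => B p - ρt (p.1, p.2.1)) :
    ∫ p in phaseBox, (f p - r (p.1, p.2.1)) * (ft p - ρt (p.1, p.2.1)) =
      ∫ p in phaseBox, (-((ε⁻¹ * g p + W p) ^ 2 / a (p.1, p.2.1)) +
        ε * ((ε⁻¹ * g p + W p) * (B p - ρt (p.1, p.2.1))) - ε * (ft p * W p)) := by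
  have cf := hf.cont
  have cDf := hf.cont_deriv
  have cr' := hr.cont
  have cr : Continuous r :=
    cr'.comp (by fun_prop : Continuous fun q : ℝ × ℝ => (q.1, q.2, (0 : ℝ)))
  have cDr := hr.cont_deriv
  have cW := hW.cont
  have cB := hW.cont_deriv
  have ca : ∀ q, a q ≠ 0 := fun q => (ha0 q).ne'
  have hu := hf.sub hr
  have z1 := ((hu.mul hu).const_mul (-(2 * ε)⁻¹)).add
    (((hu.mul hW).const_mul (-1)).add ((hW.mul hW).const_mul (-(ε / 2))))
  have z2 := mDr.integral_mul_eq_zero cDr (φ := fun q => -ε⁻¹ * (φ q - r q)) (by fun_prop)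
  have z3 := mg.integral_mul_eq_zero hg (φ := fun q => -(ε ^ 2)⁻¹ * (φ q - r q) * (a q)⁻¹)
    (by fun_prop (disch := assumption))
  have z4 := mB.integral_mul_eq_zero (by fun_prop) (φ := fun q => φ q - r q) (by fun_prop)
  have z5 := mW.integral_mul_eq_zero cW (φ := fun q => ε * ρt q) (by fun_prop)
  have c1 := z1.cont_deriv.integrableOn_phaseBox
  have c2 : IntegrableOn (fun p : ℝ × ℝ × ℝ =>
      -ε⁻¹ * (φ (p.1, p.2.1) - r (p.1, p.2.1)) * Dr p) phaseBox :=
    Continuous.integrableOn_phaseBox (by fun_prop)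
  have c3 : IntegrableOn (fun p : ℝ × ℝ × ℝ =>
      -(ε ^ 2)⁻¹ * (φ (p.1, p.2.1) - r (p.1, p.2.1)) * (a (p.1, p.2.1))⁻¹ * g p) phaseBox :=
    Continuous.integrableOn_phaseBox (by fun_prop (disch := exact fun _ => ca _))
  have c4 : IntegrableOn (fun p : ℝ × ℝ × ℝ =>
      (φ (p.1, p.2.1) - r (p.1, p.2.1)) * (B p - ρt (p.1, p.2.1))) phaseBox :=
    Continuous.integrableOn_phaseBox (by fun_prop)
  have c5 : IntegrableOn (fun p : ℝ × ℝ × ℝ => ε * ρt (p.1, p.2.1) * W p) phaseBox :=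
    Continuous.integrableOn_phaseBox (by fun_prop)
  rw [← sub_eq_zero, ← integral_sub (Continuous.integrableOn_phaseBox (by fun_prop))
    (Continuous.integrableOn_phaseBox (by fun_prop (disch := exact fun _ => ca _)))]
  rw [← z1.integral_eq_zero, ← sub_eq_zero, ← integral_sub
    (Continuous.integrableOn_phaseBox (by fun_prop (disch := exact fun _ => ca _))) c1]
  have hsum := integral_add' c2 (c3.add (c4.add c5))
  rw [integral_add' c3 (c4.add c5), integral_add' c4 c5, z2, z3, z4, z5] at hsum
  simp only [add_zero] at hsum
  rw [← hsum]
  refine setIntegral_congr_fun measurableSet_phaseBox fun p _ => ?_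
  have hp := ca (p.1, p.2.1)
  have hft' : ft p = -(ε⁻¹ * Df p) - g p / (ε ^ 2 * a (p.1, p.2.1)) := by
    have := heq p
    field_simp at this ⊢
    linarith
  simp only [Pi.add_apply, hft', hfg p, hWa p]
  field_simp
  ring

/-- Energy identity for the heat flow in kinetic form. -/
lemma diffusive_energy_identity {a ω ωt : ℝ × ℝ → ℝ} {Dω V B : ℝ × ℝ × ℝ → ℝ}
    (ha0 : ∀ q, 0 < a q) (hωt : Continuous ωt)
    (hω : HasTransportDeriv (fun p => ω (p.1, p.2.1)) Dω) (hV : HasTransportDeriv V B)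
    (hVa : ∀ p, V p = a (p.1, p.2.1) * Dω p)
    (mB : VelocityMeanZero fun p => B p - ωt (p.1, p.2.1)) :
    ∫ p in phaseBox, ω (p.1, p.2.1) * ωt (p.1, p.2.1) =
      ∫ p in phaseBox, -(V p ^ 2 / a (p.1, p.2.1)) := by
  have cω' := hω.cont
  have cω : Continuous ω :=
    cω'.comp (by fun_prop : Continuous fun q : ℝ × ℝ => (q.1, q.2, (0 : ℝ)))
  have cB := hV.cont_deriv
  have cV := hV.cont
  have cD := hω.cont_deriv
  have z1 := (hω.mul hV).integral_eq_zero
  have z2 := mB.integral_mul_eq_zero (by fun_prop) cω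
  rw [integral_add (Continuous.integrableOn_phaseBox (by fun_prop))
    (Continuous.integrableOn_phaseBox (by fun_prop))] at z1
  simp only [mul_sub] at z2
  rw [integral_sub (Continuous.integrableOn_phaseBox (by fun_prop))
    (Continuous.integrableOn_phaseBox (by fun_prop))] at z2
  have h3 : ∀ p, -(V p ^ 2 / a (p.1, p.2.1)) = -(Dω p * V p) := fun p => by
    have := (ha0 (p.1, p.2.1)).ne'
    rw [hVa p]
    field_simp
  simp only [h3, integral_neg]
  linarith

/-- Pointwise Young inequality absorbing the error terms into the dissipation. -/
lemma dissipation_absorbs {ε A Lam k b v w : ℝ} (hε : 0 < ε) (hε1 : ε ≤ 1) (hA : 0 < A)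
    (hAL : A ≤ Lam) :
    -(k ^ 2 / A) + ε * (k * b) + ε ^ 2 * ((k - w) * v) -
      ε ^ 2 * ((Lam ^ 2 + Lam) / 2) * (v ^ 2 / A) ≤ ε ^ 2 * (A * b ^ 2 + w ^ 2) := by
  have h1 : ε * (k * b) ≤ k ^ 2 / A / 2 + ε ^ 2 * (A * b ^ 2) / 2 := by
    have : 0 ≤ (k - ε * A * b) ^ 2 / A := by positivity
    have e : (k - ε * A * b) ^ 2 / A = k ^ 2 / A - 2 * (ε * (k * b)) + ε ^ 2 * (A * b ^ 2) := by
      field_simp; ring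
    linarith
  have h2 : ε ^ 2 * (k * v) ≤ k ^ 2 / A / 2 + ε ^ 2 * (A * v ^ 2) / 2 := by
    have h : 0 ≤ (k - A * v) ^ 2 / A := by positivity
    have e : (k - A * v) ^ 2 / A = k ^ 2 / A - 2 * (k * v) + A * v ^ 2 := by
      field_simp; ring
    have h3 : ε ^ 2 * (k ^ 2 / A) ≤ k ^ 2 / A :=
      mul_le_of_le_one_left (by positivity) (by nlinarith)
    nlinarith [mul_nonneg (sq_nonneg ε) h]
  have h4 : A * v ^ 2 ≤ Lam ^ 2 * (v ^ 2 / A) := by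
    have : A * v ^ 2 = A ^ 2 * (v ^ 2 / A) := by field_simp
    rw [this]
    gcongr
  have h5 : v ^ 2 ≤ Lam * (v ^ 2 / A) := by
    have : v ^ 2 = A * (v ^ 2 / A) := by field_simp
    nth_rewrite 1 [this]
    gcongr
  have h6 : 0 ≤ ε ^ 2 * (A * b ^ 2) := by positivity
  nlinarith [mul_le_mul_of_nonneg_left h4 (sq_nonneg ε), mul_le_mul_of_nonneg_left h5 (sq_nonneg ε),
    mul_nonneg (sq_nonneg ε) (sq_nonneg (w + v)), mul_nonneg (sq_nonneg ε) (sq_nonneg w)]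

/-- Dissipation inequality for the corrected energy at a fixed time. -/
lemma corrected_energy_rate_le {ε Lam : ℝ} (hε : 0 < ε) (hε1 : ε ≤ 1) {a r φ ρt ω ωt : ℝ × ℝ → ℝ}
    {f ft Df g Dr W B V Dω Vd Bd : ℝ × ℝ × ℝ → ℝ} (ha : Continuous a) (ha0 : ∀ q, 0 < a q)
    (haL : ∀ q, a q ≤ Lam)
    (hφ : Continuous φ) (hρt : Continuous ρt) (hft : Continuous ft) (hg : Continuous g)
    (hf : HasTransportDeriv f Df) (hr : HasTransportDeriv (fun p => r (p.1, p.2.1)) Dr)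
    (hW : HasTransportDeriv W B) (hWa : ∀ p, W p = a (p.1, p.2.1) * Dr p)
    (hfg : ∀ p, f p = φ (p.1, p.2.1) + g p)
    (heq : ∀ p, ε * a (p.1, p.2.1) * ft p + a (p.1, p.2.1) * Df p = -(ε⁻¹ * g p))
    (mg : VelocityMeanZero g) (mW : VelocityMeanZero W) (mDr : VelocityMeanZero Dr)
    (mB : VelocityMeanZero fun p => B p - ρt (p.1, p.2.1))
    (hV : Continuous V) (hωt : Continuous ωt)
    (hω : HasTransportDeriv (fun p => ω (p.1, p.2.1)) Dω) (hVd : HasTransportDeriv Vd Bd)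
    (hVda : ∀ p, Vd p = a (p.1, p.2.1) * Dω p) (mVd : VelocityMeanZero Vd)
    (mBd : VelocityMeanZero fun p => Bd p - ωt (p.1, p.2.1)) :
    (∫ p in phaseBox, (f p - r (p.1, p.2.1)) * (ft p - ρt (p.1, p.2.1))) +
      ε * (∫ p in phaseBox, (ft p * V p + f p * Vd p)) +
      ε ^ 2 * ((Lam ^ 2 + Lam) / 2) * ∫ p in phaseBox, ω (p.1, p.2.1) * ωt (p.1, p.2.1) ≤
    ε ^ 2 * (∫ p in phaseBox, (a (p.1, p.2.1) * (B p - ρt (p.1, p.2.1)) ^ 2 + W p ^ 2)) +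
      ε * ∫ p in phaseBox, ft p * (V p - W p) := by
  rw [kinetic_energy_identity hε ha ha0 hφ hρt hft hg hf hr hW hWa hfg heq mg mW mDr mB,
    diffusive_energy_identity ha0 hωt hω hVd hVda mBd]
  have z := mVd.integral_mul_eq_zero hVd.cont hφ
  have ca : ∀ q, a q ≠ 0 := fun q => (ha0 q).ne'
  have cf := hf.cont
  have cW := hW.cont
  have cB := hW.cont_deriv
  have cVd := hVd.cont
  have hz : ε * ∫ p in phaseBox, (ft p * V p + f p * Vd p) =
      ∫ p in phaseBox, (ε * (ft p * V p) + ε * (g p * Vd p)) := by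
    rw [← add_zero (∫ p in phaseBox, (ε * (ft p * V p) + ε * (g p * Vd p))),
      ← mul_zero ε, ← z, ← integral_const_mul, ← integral_const_mul, ← integral_add
      (Continuous.integrableOn_phaseBox (by fun_prop))
      (Continuous.integrableOn_phaseBox (by fun_prop))]
    exact setIntegral_congr_fun measurableSet_phaseBox fun p _ => by simp only [hfg p]; ring
  rw [hz]
  simp only [← integral_const_mul]
  rw [← integral_add (Continuous.integrableOn_phaseBox (by fun_prop (disch := exact fun _ => ca _)))
      (Continuous.integrableOn_phaseBox (by fun_prop (disch := exact fun _ => ca _))),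
    ← integral_add (Continuous.integrableOn_phaseBox (by fun_prop (disch := exact fun _ => ca _)))
      (Continuous.integrableOn_phaseBox (by fun_prop (disch := exact fun _ => ca _))),
    ← integral_add (Continuous.integrableOn_phaseBox (by fun_prop (disch := exact fun _ => ca _)))
      (Continuous.integrableOn_phaseBox (by fun_prop (disch := exact fun _ => ca _)))]
  refine integral_phaseBox_mono (by fun_prop (disch := exact fun _ => ca _)) (by fun_prop)
    fun p _ => ?_
  have h := dissipation_absorbs (k := ε⁻¹ * g p + W p) (b := B p - ρt (p.1, p.2.1)) (v := Vd p)
    (w := W p) hε hε1 (ha0 (p.1, p.2.1)) (haL (p.1, p.2.1))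
  have e : ε ^ 2 * ((ε⁻¹ * g p + W p - W p) * Vd p) = ε * (g p * Vd p) := by
    field_simp; ring
  rw [e] at h
  linarith

/-- A periodic solution `ρ` of `∂ₜρ = ½ ∇·(a∇ρ)` on `[0, T]`, with names for all its derivatives.
The time variable is the first coordinate of the arguments of `ρ`, `ρt`, `ρx`, `ρy`. -/
structure IsHeatFlow (T lam Lam : ℝ) (a ax ay : ℝ × ℝ → ℝ) (ρ ρt ρx ρy : ℝ × ℝ × ℝ → ℝ)
    (ρxx ρxy ρyy : ℝ → ℝ × ℝ → ℝ) : Prop where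
  lam_pos : 0 < lam
  cont_a : Continuous a
  cont_ax : Continuous ax
  cont_ay : Continuous ay
  deriv_ax : ∀ x y, HasDerivAt (fun s => a (s, y)) (ax (x, y)) x
  deriv_ay : ∀ x y, HasDerivAt (fun s => a (x, s)) (ay (x, y)) y
  per_ax : ∀ x y, a (x + 1, y) = a (x, y)
  per_ay : ∀ x y, a (x, y + 1) = a (x, y)
  lam_le : ∀ q, lam ≤ a q
  le_Lam : ∀ q, a q ≤ Lam
  cont : Continuous ρ
  cont_t : Continuous ρt
  cont_x : Continuous ρx
  cont_y : Continuous ρy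
  cont_xx : ∀ t, Continuous (ρxx t)
  cont_xy : ∀ t, Continuous (ρxy t)
  cont_yy : ∀ t, Continuous (ρyy t)
  deriv_t : ∀ t q, HasDerivAt (fun s => ρ (s, q)) (ρt (t, q)) t
  deriv_x : ∀ t x y, HasDerivAt (fun s => ρ (t, s, y)) (ρx (t, x, y)) x
  deriv_y : ∀ t x y, HasDerivAt (fun s => ρ (t, x, s)) (ρy (t, x, y)) y
  deriv_xx : ∀ t x y, HasDerivAt (fun s => ρx (t, s, y)) (ρxx t (x, y)) x
  deriv_xy : ∀ t x y, HasDerivAt (fun s => ρx (t, x, s)) (ρxy t (x, y)) y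
  deriv_yx : ∀ t x y, HasDerivAt (fun s => ρy (t, s, y)) (ρxy t (x, y)) x
  deriv_yy : ∀ t x y, HasDerivAt (fun s => ρy (t, x, s)) (ρyy t (x, y)) y
  per_x : ∀ t x y, ρ (t, x + 1, y) = ρ (t, x, y)
  per_y : ∀ t x y, ρ (t, x, y + 1) = ρ (t, x, y)
  heat : ∀ t ∈ Set.Icc 0 T, ∀ q, ρt (t, q) =
    1 / 2 * (ax q * ρx (t, q) + a q * ρxx t q + (ay q * ρy (t, q) + a q * ρyy t q))

/-- The velocity component `v · ∇ρ` of the gradient. -/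
noncomputable def velocityGrad (ρx ρy : ℝ × ℝ × ℝ → ℝ) (q : ℝ × ℝ × ℝ × ℝ) : ℝ :=
  cos q.2.2.2 * ρx (q.1, q.2.1, q.2.2.1) + sin q.2.2.2 * ρy (q.1, q.2.1, q.2.2.1)

/-- The velocity component `a v · ∇ρ` of the diffusive flux. -/
noncomputable def velocityFlux (a : ℝ × ℝ → ℝ) (ρx ρy : ℝ × ℝ × ℝ → ℝ) (q : ℝ × ℝ × ℝ × ℝ) : ℝ :=
  a (q.2.1, q.2.2.1) * velocityGrad ρx ρy q

/-- The transport derivative `v · ∇(a v · ∇ρ)` of the velocity flux. -/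
noncomputable def velocityFluxDeriv (a ax ay : ℝ × ℝ → ℝ) (ρx ρy : ℝ × ℝ × ℝ → ℝ)
    (ρxx ρxy ρyy : ℝ → ℝ × ℝ → ℝ) (t : ℝ) (p : ℝ × ℝ × ℝ) : ℝ :=
  cos p.2.2 * (ax (p.1, p.2.1) * velocityGrad ρx ρy (t, p) + a (p.1, p.2.1) *
      (cos p.2.2 * ρxx t (p.1, p.2.1) + sin p.2.2 * ρxy t (p.1, p.2.1))) +
    sin p.2.2 * (ay (p.1, p.2.1) * velocityGrad ρx ρy (t, p) + a (p.1, p.2.1) *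
      (cos p.2.2 * ρxy t (p.1, p.2.1) + sin p.2.2 * ρyy t (p.1, p.2.1)))

lemma exists_bound_on_phaseBox (T : ℝ) {F : ℝ × ℝ × ℝ × ℝ → ℝ} (hF : Continuous F) :
    ∃ M, 0 ≤ M ∧ ∀ t ∈ Set.Icc 0 T, ∀ p ∈ phaseBox, |F (t, p)| ≤ M := by
  obtain ⟨M, hM⟩ := ((isCompact_Icc (a := 0) (b := T)).prod
    isCompact_phaseBox).exists_bound_of_continuousOn hF.continuousOn
  exact ⟨max M 0, le_max_right _ _, fun t ht p hp => (hM (t, p) ⟨ht, hp⟩).trans (le_max_left _ _)⟩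

lemma hessian_form_sq_le (X Y Z ξ : ℝ) :
    (cos ξ ^ 2 * X + 2 * (cos ξ * sin ξ) * Y + sin ξ ^ 2 * Z) ^ 2 ≤ X ^ 2 + 2 * Y ^ 2 + Z ^ 2 := by
  have h : X ^ 2 + 2 * Y ^ 2 + Z ^ 2 =
      (X ^ 2 + 2 * Y ^ 2 + Z ^ 2) * (sin ξ ^ 2 + cos ξ ^ 2) ^ 2 := by
    rw [sin_sq_add_cos_sq]; ring
  rw [h]
  nlinarith [sq_nonneg (X * (cos ξ * sin ξ) - Y * cos ξ ^ 2),
    sq_nonneg (X * sin ξ ^ 2 - Z * cos ξ ^ 2), sq_nonneg (Y * sin ξ ^ 2 - Z * (cos ξ * sin ξ))]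

lemma quadratic_split_le {A L e k M H : ℝ} (hA : 0 < A) (hL : A ≤ L) (he : e ^ 2 ≤ M ^ 2)
    (hk : k ^ 2 ≤ H) : A * (e + A * k) ^ 2 ≤ 2 * L * M ^ 2 + 2 * L ^ 3 * H := by
  calc A * (e + A * k) ^ 2 ≤ 2 * A * e ^ 2 + 2 * A ^ 3 * k ^ 2 := by
        nlinarith [mul_nonneg hA.le (sq_nonneg (e - A * k))]
    _ ≤ 2 * L * M ^ 2 + 2 * L ^ 3 * H := by
        have hH := (sq_nonneg k).trans hk
        have hL0 := hA.le.trans hL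
        gcongr

namespace IsHeatFlow

variable {T lam Lam : ℝ} {a ax ay : ℝ × ℝ → ℝ} {ρ ρt ρx ρy : ℝ × ℝ × ℝ → ℝ}
  {ρxx ρxy ρyy : ℝ → ℝ × ℝ → ℝ}

lemma a_pos (h : IsHeatFlow T lam Lam a ax ay ρ ρt ρx ρy ρxx ρxy ρyy) (q : ℝ × ℝ) : 0 < a q :=
  h.lam_pos.trans_le (h.lam_le q)

lemma spatialGrad (h : IsHeatFlow T lam Lam a ax ay ρ ρt ρx ρy ρxx ρxy ρyy) (t : ℝ) :
    HasSpatialGrad (fun p => ρ (t, p.1, p.2.1)) (fun p => ρx (t, p.1, p.2.1))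
      (fun p => ρy (t, p.1, p.2.1)) := by
  have h1 := h.cont
  have h2 := h.cont_x
  have h3 := h.cont_y
  exact ⟨by fun_prop, by fun_prop, by fun_prop, fun x y _ => h.deriv_x t x y,
    fun x y _ => h.deriv_y t x y, fun x y _ => h.per_x t x y, fun x y _ => h.per_y t x y⟩

lemma spatialGrad_x (h : IsHeatFlow T lam Lam a ax ay ρ ρt ρx ρy ρxx ρxy ρyy) (t : ℝ) :
    HasSpatialGrad (fun p => ρx (t, p.1, p.2.1)) (fun p => ρxx t (p.1, p.2.1))
      (fun p => ρxy t (p.1, p.2.1)) := by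
  have h1 := h.cont_x
  have h2 := h.cont_xx t
  have h3 := h.cont_xy t
  refine ⟨by fun_prop, by fun_prop, by fun_prop, fun x y _ => h.deriv_xx t x y,
    fun x y _ => h.deriv_xy t x y, fun x y _ => ?_, fun x y _ => ?_⟩
  · have := (h.deriv_x t (x + 1) y).comp_add_const x 1
    simp only [h.per_x] at this
    exact this.unique (h.deriv_x t x y)
  · have := h.deriv_x t x (y + 1)
    simp only [h.per_y] at this
    exact this.unique (h.deriv_x t x y)

lemma spatialGrad_y (h : IsHeatFlow T lam Lam a ax ay ρ ρt ρx ρy ρxx ρxy ρyy) (t : ℝ) :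
    HasSpatialGrad (fun p => ρy (t, p.1, p.2.1)) (fun p => ρxy t (p.1, p.2.1))
      (fun p => ρyy t (p.1, p.2.1)) := by
  have h1 := h.cont_y
  have h2 := h.cont_xy t
  have h3 := h.cont_yy t
  refine ⟨by fun_prop, by fun_prop, by fun_prop, fun x y _ => h.deriv_yx t x y,
    fun x y _ => h.deriv_yy t x y, fun x y _ => ?_, fun x y _ => ?_⟩
  · have := h.deriv_y t (x + 1) y
    simp only [h.per_x] at this
    exact this.unique (h.deriv_y t x y)
  · have := (h.deriv_y t x (y + 1)).comp_add_const y 1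
    simp only [h.per_y] at this
    exact this.unique (h.deriv_y t x y)

lemma spatialGrad_a (h : IsHeatFlow T lam Lam a ax ay ρ ρt ρx ρy ρxx ρxy ρyy) :
    HasSpatialGrad (fun p => a (p.1, p.2.1)) (fun p => ax (p.1, p.2.1))
      (fun p => ay (p.1, p.2.1)) := by
  have h1 := h.cont_a
  have h2 := h.cont_ax
  have h3 := h.cont_ay
  exact ⟨by fun_prop, by fun_prop, by fun_prop, fun x y _ => h.deriv_ax x y,
    fun x y _ => h.deriv_ay x y, fun x y _ => h.per_ax x y, fun x y _ => h.per_ay x y⟩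

lemma transportDeriv (h : IsHeatFlow T lam Lam a ax ay ρ ρt ρx ρy ρxx ρxy ρyy) (t : ℝ) :
    HasTransportDeriv (fun p => ρ (t, p.1, p.2.1)) (fun p => velocityGrad ρx ρy (t, p)) :=
  ⟨_, _, h.spatialGrad t, fun _ => rfl⟩

lemma transportDeriv_flux (h : IsHeatFlow T lam Lam a ax ay ρ ρt ρx ρy ρxx ρxy ρyy) (t : ℝ) :
    HasTransportDeriv (fun p => velocityFlux a ρx ρy (t, p))
      (velocityFluxDeriv a ax ay ρx ρy ρxx ρxy ρyy t) :=
  ⟨_, _, h.spatialGrad_a.mul (((HasSpatialGrad.of_velocity continuous_cos).mul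
    (h.spatialGrad_x t)).add ((HasSpatialGrad.of_velocity continuous_sin).mul (h.spatialGrad_y t))),
    fun p => by simp only [velocityFluxDeriv, velocityGrad]; ring⟩

lemma continuous_velocityGrad (h : IsHeatFlow T lam Lam a ax ay ρ ρt ρx ρy ρxx ρxy ρyy) :
    Continuous (velocityGrad ρx ρy) := by
  have h1 := h.cont_x
  have h2 := h.cont_y
  unfold velocityGrad; fun_prop

lemma continuous_velocityFlux (h : IsHeatFlow T lam Lam a ax ay ρ ρt ρx ρy ρxx ρxy ρyy) :
    Continuous (velocityFlux a ρx ρy) := by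
  have h1 := h.continuous_velocityGrad
  have h2 := h.cont_a
  unfold velocityFlux; fun_prop

lemma meanZero_fluxDeriv_sub (h : IsHeatFlow T lam Lam a ax ay ρ ρt ρx ρy ρxx ρxy ρyy) {t : ℝ}
    (ht : t ∈ Set.Icc 0 T) :
    VelocityMeanZero fun p =>
      velocityFluxDeriv a ax ay ρx ρy ρxx ρxy ρyy t p - ρt (t, p.1, p.2.1) := by
  convert velocityMeanZero_quadratic (fun q => ax q * ρx (t, q) + a q * ρxx t q)
    (fun q => ay q * ρy (t, q) + a q * ρyy t q)
    (fun q => ax q * ρy (t, q) + ay q * ρx (t, q) + 2 * a q * ρxy t q) using 2 with p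
  rw [h.heat t ht]
  simp only [velocityFluxDeriv, velocityGrad]
  ring

/-- The full Hessian is controlled in mean square by the Laplacian. -/
lemma integral_hessian_sq (h : IsHeatFlow T lam Lam a ax ay ρ ρt ρx ρy ρxx ρxy ρyy) (t : ℝ) :
    ∫ p : ℝ × ℝ × ℝ in phaseBox, (ρxx t (p.1, p.2.1) ^ 2 + 2 * ρxy t (p.1, p.2.1) ^ 2 +
      ρyy t (p.1, p.2.1) ^ 2) =
    ∫ p : ℝ × ℝ × ℝ in phaseBox, (ρxx t (p.1, p.2.1) + ρyy t (p.1, p.2.1)) ^ 2 := by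
  have h1 := h.cont_xx t
  have h2 := h.cont_xy t
  have h3 := h.cont_yy t
  have key := (h.spatialGrad_x t).integral_jacobian (h.spatialGrad_y t)
  rw [← sub_eq_zero, ← integral_sub (Continuous.integrableOn_phaseBox (by fun_prop))
    (Continuous.integrableOn_phaseBox (by fun_prop))] at key ⊢
  rw [← mul_eq_zero_of_right (-2) key, ← integral_const_mul]
  exact setIntegral_congr_fun measurableSet_phaseBox fun p _ => by ring

lemma exists_source_bound (h : IsHeatFlow T lam Lam a ax ay ρ ρt ρx ρy ρxx ρxy ρyy) :
    ∃ C, 0 ≤ C ∧ ∀ t ∈ Set.Icc 0 T, ∫ p in phaseBox,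
      (a (p.1, p.2.1) * (velocityFluxDeriv a ax ay ρx ρy ρxx ρxy ρyy t p -
        ρt (t, p.1, p.2.1)) ^ 2 + velocityFlux a ρx ρy (t, p) ^ 2) ≤ C := by
  have ca := h.cont_a
  have cax := h.cont_ax
  have cay := h.cont_ay
  have ct := h.cont_t
  have cx := h.cont_x
  have cy := h.cont_y
  have cv := h.continuous_velocityGrad
  have cW := h.continuous_velocityFlux
  obtain ⟨M₁, hM₁, b₁⟩ := exists_bound_on_phaseBox T (F := fun q =>
    (2 * ρt (q.1, q.2.1, q.2.2.1) - ax (q.2.1, q.2.2.1) * ρx (q.1, q.2.1, q.2.2.1) -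
      ay (q.2.1, q.2.2.1) * ρy (q.1, q.2.1, q.2.2.1))) (by fun_prop)
  obtain ⟨M₂, hM₂, b₂⟩ := exists_bound_on_phaseBox T (F := fun q =>
    (cos q.2.2.2 * ax (q.2.1, q.2.2.1) + sin q.2.2.2 * ay (q.2.1, q.2.2.1)) *
      velocityGrad ρx ρy q - ρt (q.1, q.2.1, q.2.2.1)) (by fun_prop)
  obtain ⟨M₃, hM₃, b₃⟩ := exists_bound_on_phaseBox T cW
  have hLam : 0 < Lam := (h.a_pos 0).trans_le (h.le_Lam 0)
  have hlam := h.lam_pos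
  refine ⟨2 * π * (2 * Lam * M₂ ^ 2 + M₃ ^ 2) + 2 * Lam ^ 3 * (2 * π * (M₁ / lam) ^ 2),
    by positivity, fun t ht => ?_⟩
  have cxx := h.cont_xx t
  have cxy := h.cont_xy t
  have cyy := h.cont_yy t
  have cB := (h.transportDeriv_flux t).cont_deriv
  have hlap : ∫ p : ℝ × ℝ × ℝ in phaseBox, (ρxx t (p.1, p.2.1) + ρyy t (p.1, p.2.1)) ^ 2 ≤
      2 * π * (M₁ / lam) ^ 2 := by
    refine integral_phaseBox_le (by fun_prop) fun p hp => ?_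
    have hb := b₁ t ht p hp
    simp only at hb
    have hl := h.lam_le (p.1, p.2.1)
    have e : 2 * ρt (t, p.1, p.2.1) - ax (p.1, p.2.1) * ρx (t, p.1, p.2.1) -
        ay (p.1, p.2.1) * ρy (t, p.1, p.2.1) =
        a (p.1, p.2.1) * (ρxx t (p.1, p.2.1) + ρyy t (p.1, p.2.1)) := by
      rw [h.heat t ht]; ring
    rw [e, abs_mul, abs_of_pos (h.a_pos _)] at hb
    rw [← sq_abs]
    gcongr
    rw [le_div_iff₀' hlam]
    exact (mul_le_mul_of_nonneg_right hl (abs_nonneg _)).trans hb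
  calc _ ≤ ∫ p : ℝ × ℝ × ℝ in phaseBox, ((2 * Lam * M₂ ^ 2 + M₃ ^ 2) + 2 * Lam ^ 3 *
        (ρxx t (p.1, p.2.1) ^ 2 + 2 * ρxy t (p.1, p.2.1) ^ 2 + ρyy t (p.1, p.2.1) ^ 2)) := by
        refine integral_phaseBox_mono (by fun_prop) (by fun_prop) fun p hp => ?_
        have hb₂ := b₂ t ht p hp
        have hb₃ := b₃ t ht p hp
        have h3 : velocityFlux a ρx ρy (t, p) ^ 2 ≤ M₃ ^ 2 :=
          sq_le_sq' (abs_le.1 hb₃).1 (abs_le.1 hb₃).2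
        have h2 := sq_le_sq' (abs_le.1 hb₂).1 (abs_le.1 hb₂).2
        have hm := quadratic_split_le (h.a_pos (p.1, p.2.1)) (h.le_Lam (p.1, p.2.1)) h2
          (hessian_form_sq_le (ρxx t (p.1, p.2.1)) (ρxy t (p.1, p.2.1)) (ρyy t (p.1, p.2.1)) p.2.2)
        have e : velocityFluxDeriv a ax ay ρx ρy ρxx ρxy ρyy t p - ρt (t, p.1, p.2.1) =
            ((cos p.2.2 * ax (p.1, p.2.1) + sin p.2.2 * ay (p.1, p.2.1)) *
              velocityGrad ρx ρy (t, p) - ρt (t, p.1, p.2.1)) + a (p.1, p.2.1) *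
            (cos p.2.2 ^ 2 * ρxx t (p.1, p.2.1) + 2 * (cos p.2.2 * sin p.2.2) *
              ρxy t (p.1, p.2.1) + sin p.2.2 ^ 2 * ρyy t (p.1, p.2.1)) := by
          simp only [velocityFluxDeriv]; ring
        rw [e]
        linarith
    _ ≤ _ := by
        rw [integral_add (Continuous.integrableOn_phaseBox (by fun_prop))
          (Continuous.integrableOn_phaseBox (by fun_prop)), integral_const_mul,
          h.integral_hessian_sq t, setIntegral_const, volume_real_phaseBox, smul_eq_mul]
        gcongr

end IsHeatFlow

/-- The velocity average of a phase-space function. -/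
noncomputable def velocityMean (F : ℝ × ℝ × ℝ → ℝ) (q : ℝ × ℝ) : ℝ :=
  (2 * π)⁻¹ * ∫ ζ in Set.Ioc (-π) π, F (q.1, q.2, ζ)

lemma continuous_velocityMean {F : ℝ × ℝ × ℝ → ℝ} (hF : Continuous F) :
    Continuous (velocityMean F) := by
  unfold velocityMean
  simp only [← intervalIntegral.integral_of_le (by linarith [pi_pos] : -π ≤ π)]
  exact continuous_const.mul (intervalIntegral.continuous_parametric_intervalIntegral_of_continuous'
    (by unfold Function.uncurry; fun_prop) _ _)

lemma velocityMeanZero_sub_mean {F : ℝ × ℝ × ℝ → ℝ} (hF : Continuous F) :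
    VelocityMeanZero fun p => F p - velocityMean F (p.1, p.2.1) := by
  intro x y
  have hc : IntegrableOn (fun ξ => F (x, y, ξ)) (Set.Ioc (-π) π) :=
    (by fun_prop : Continuous fun ξ => F (x, y, ξ)).integrableOn_Ioc
  simp only
  rw [integral_sub hc (by fun_prop), setIntegral_const, velocityMean]
  simp only [Real.volume_real_Ioc_of_le (by linarith [pi_pos] : -π ≤ π), smul_eq_mul]
  have := pi_pos.ne'
  field_simp
  ring

/-- The forward time average over a window of length `h`. -/
noncomputable def timeAverage (h : ℝ) (F : ℝ × ℝ × ℝ × ℝ → ℝ) (q : ℝ × ℝ × ℝ × ℝ) : ℝ :=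
  h⁻¹ * ∫ s in q.1..q.1 + h, F (s, q.2)

lemma timeAverage_eq_sub {F : ℝ × ℝ × ℝ × ℝ → ℝ} (hF : Continuous F) (h : ℝ)
    (q : ℝ × ℝ × ℝ × ℝ) : timeAverage h F q =
      h⁻¹ * ((∫ s in (0 : ℝ)..q.1 + h, F (s, q.2)) - ∫ s in (0 : ℝ)..q.1, F (s, q.2)) := by
  rw [timeAverage, intervalIntegral.integral_interval_sub_left] <;>
  exact Continuous.intervalIntegrable (by fun_prop) _ _

lemma continuous_timeAverage {F : ℝ × ℝ × ℝ × ℝ → ℝ} (hF : Continuous F) (h : ℝ) :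
    Continuous (timeAverage h F) := by
  rw [funext (timeAverage_eq_sub hF h)]
  have hc : Continuous (Function.uncurry fun (q : ℝ × ℝ × ℝ × ℝ) (s : ℝ) => F (s, q.2)) := by
    unfold Function.uncurry; fun_prop
  exact continuous_const.mul
    ((intervalIntegral.continuous_parametric_intervalIntegral_of_continuous hc (by fun_prop)).sub
      (intervalIntegral.continuous_parametric_intervalIntegral_of_continuous hc (by fun_prop)))

lemma hasDerivAt_timeAverage {F : ℝ × ℝ × ℝ × ℝ → ℝ} (hF : Continuous F) (h t : ℝ)
    (p : ℝ × ℝ × ℝ) :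
    HasDerivAt (fun s => timeAverage h F (s, p)) (h⁻¹ * (F (t + h, p) - F (t, p))) t := by
  simp only [timeAverage_eq_sub hF]
  have hc : Continuous fun s => F (s, p) := by fun_prop
  have hd : ∀ τ, HasDerivAt (fun s => ∫ r in (0 : ℝ)..s, F (r, p)) (F (τ, p)) τ := fun τ =>
    intervalIntegral.integral_hasDerivAt_right (hc.intervalIntegrable _ _)
      hc.stronglyMeasurable.stronglyMeasurableAtFilter hc.continuousAt
  exact (((hd (t + h)).comp_add_const t h).sub (hd t)).const_mul _

lemma abs_timeAverage_sub_le {F : ℝ × ℝ × ℝ × ℝ → ℝ} (hF : Continuous F) {h t δ c : ℝ}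
    (hh : 0 < h) {p : ℝ × ℝ × ℝ} (hδ : ∀ s ∈ Set.Icc t (t + h), |F (s, p) - c| ≤ δ) :
    |timeAverage h F (t, p) - c| ≤ δ := by
  have hc : Continuous fun s => F (s, p) := by fun_prop
  have e : timeAverage h F (t, p) - c = h⁻¹ * ∫ s in t..t + h, (F (s, p) - c) := by
    rw [intervalIntegral.integral_sub (hc.intervalIntegrable _ _) (by simp),
      intervalIntegral.integral_const, timeAverage]
    simp only [smul_eq_mul]
    field_simp
    ring
  have hb := intervalIntegral.norm_integral_le_of_norm_le_const (a := t) (b := t + h) (C := δ)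
    (f := fun s => F (s, p) - c) fun s hs => by
      rw [Set.uIoc_of_le (by linarith)] at hs
      exact hδ s ⟨hs.1.le, hs.2⟩
  rw [e, abs_mul, abs_of_pos (inv_pos.2 hh), inv_mul_le_iff₀ hh]
  rw [add_sub_cancel_left, abs_of_pos hh, mul_comm] at hb
  exact hb

lemma exists_time_modulus (T : ℝ) {F : ℝ × ℝ × ℝ × ℝ → ℝ} (hF : Continuous F) {δ : ℝ}
    (hδ : 0 < δ) : ∃ η > 0, ∀ s ∈ Set.Icc 0 T, ∀ t ∈ Set.Icc 0 T, |s - t| < η →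
      ∀ p ∈ phaseBox, |F (s, p) - F (t, p)| ≤ δ := by
  have huc := ((isCompact_Icc (a := 0) (b := T)).prod
    isCompact_phaseBox).uniformContinuousOn_of_continuous hF.continuousOn
  obtain ⟨η, hη, H⟩ := Metric.uniformContinuousOn_iff.1 huc δ hδ
  refine ⟨η, hη, fun s hs t ht hst p hp => ?_⟩
  have := H (s, p) ⟨hs, hp⟩ (t, p) ⟨ht, hp⟩ (by
    simpa [Prod.dist_eq, Real.dist_eq] using hst)
  rw [Real.dist_eq] at this
  exact this.le

lemma velocityMeanZero_velocityGrad (ρx ρy : ℝ × ℝ × ℝ → ℝ) (t : ℝ) :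
    VelocityMeanZero fun p => velocityGrad ρx ρy (t, p) :=
  velocityMeanZero_cos_add_sin (fun q => ρx (t, q)) (fun q => ρy (t, q))

lemma velocityMeanZero_velocityFlux (a : ℝ × ℝ → ℝ) (ρx ρy : ℝ × ℝ × ℝ → ℝ) (t : ℝ) :
    VelocityMeanZero fun p => velocityFlux a ρx ρy (t, p) := by
  intro x y
  simp only [velocityFlux, integral_const_mul]
  rw [velocityMeanZero_velocityGrad ρx ρy t x y, mul_zero]

lemma velocityMeanZero_timeAverage_flux (a : ℝ × ℝ → ℝ) {ρx ρy : ℝ × ℝ × ℝ → ℝ}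
    (hx : Continuous ρx) (hy : Continuous ρy) (h t : ℝ) :
    VelocityMeanZero fun p => timeAverage h (velocityFlux a ρx ρy) (t, p) := by
  convert velocityMeanZero_cos_add_sin
    (fun q => h⁻¹ * (a q * ∫ s in t..t + h, ρx (s, q)))
    (fun q => h⁻¹ * (a q * ∫ s in t..t + h, ρy (s, q))) using 2 with p
  simp only [timeAverage, velocityFlux, velocityGrad]
  rw [intervalIntegral.integral_const_mul, intervalIntegral.integral_add
    (Continuous.intervalIntegrable (by fun_prop) _ _)
    (Continuous.intervalIntegrable (by fun_prop) _ _), intervalIntegral.integral_const_mul,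
    intervalIntegral.integral_const_mul]
  ring

/-- A periodic `C¹` solution of the scaled transport equation on `[0, T]` with
velocity-independent initial datum `ρ₀`, with names for its partial derivatives. -/
structure IsKineticSolution (T ε : ℝ) (a ρ₀ : ℝ × ℝ → ℝ) (f ft fx fy : ℝ × ℝ × ℝ × ℝ → ℝ) :
    Prop where
  cont : Continuous f
  cont_t : Continuous ft
  cont_x : Continuous fx
  cont_y : Continuous fy
  deriv_t : ∀ t p, HasDerivAt (fun s => f (s, p)) (ft (t, p)) t
  deriv_x : ∀ t x y ξ, HasDerivAt (fun s => f (t, s, y, ξ)) (fx (t, x, y, ξ)) x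
  deriv_y : ∀ t x y ξ, HasDerivAt (fun s => f (t, x, s, ξ)) (fy (t, x, y, ξ)) y
  per_x : ∀ t x y ξ, f (t, x + 1, y, ξ) = f (t, x, y, ξ)
  per_y : ∀ t x y ξ, f (t, x, y + 1, ξ) = f (t, x, y, ξ)
  init : ∀ p, f (0, p) = ρ₀ (p.1, p.2.1)
  transport : ∀ t ∈ Set.Icc 0 T, ∀ p : ℝ × ℝ × ℝ, ε * a (p.1, p.2.1) * ft (t, p) +
    a (p.1, p.2.1) * (cos p.2.2 * fx (t, p) + sin p.2.2 * fy (t, p)) =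
      -(ε⁻¹ * (f (t, p) - velocityMean (fun p => f (t, p)) (p.1, p.2.1)))

lemma IsKineticSolution.transportDeriv {T ε : ℝ} {a ρ₀ : ℝ × ℝ → ℝ}
    {f ft fx fy : ℝ × ℝ × ℝ × ℝ → ℝ} (h : IsKineticSolution T ε a ρ₀ f ft fx fy) (t : ℝ) :
    HasTransportDeriv (fun p => f (t, p))
      (fun p => cos p.2.2 * fx (t, p) + sin p.2.2 * fy (t, p)) := by
  have h1 := h.cont
  have h2 := h.cont_x
  have h3 := h.cont_y
  exact ⟨_, _, ⟨by fun_prop, by fun_prop, by fun_prop, h.deriv_x t, h.deriv_y t, h.per_x t,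
    h.per_y t⟩, fun _ => rfl⟩

section ErrorEstimate

variable {T lam Lam ε : ℝ} {a ax ay : ℝ × ℝ → ℝ} {ρ ρt ρx ρy : ℝ × ℝ × ℝ → ℝ}
  {ρxx ρxy ρyy : ℝ → ℝ × ℝ → ℝ} {f ft fx fy : ℝ × ℝ × ℝ × ℝ → ℝ}

/-- The squared error, corrected by the time-averaged flux and by the energy of the time difference
quotient of the heat flow. -/
noncomputable def correctedEnergy (ε Lam h : ℝ) (a : ℝ × ℝ → ℝ) (ρ ρx ρy : ℝ × ℝ × ℝ → ℝ)
    (f : ℝ × ℝ × ℝ × ℝ → ℝ) (t : ℝ) : ℝ :=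
  (∫ p in phaseBox, (f (t, p) - ρ (t, p.1, p.2.1)) ^ 2 / 2) +
    ε * (∫ p in phaseBox, f (t, p) * timeAverage h (velocityFlux a ρx ρy) (t, p)) +
    ε ^ 2 * ((Lam ^ 2 + Lam) / 2) * ∫ p : ℝ × ℝ × ℝ in phaseBox,
      (h⁻¹ * (ρ (t + h, p.1, p.2.1) - ρ (t, p.1, p.2.1))) ^ 2 / 2

lemma exists_hasDerivAt_correctedEnergy
    (H : IsHeatFlow T lam Lam a ax ay ρ ρt ρx ρy ρxx ρxy ρyy)
    (K : IsKineticSolution T ε a (fun q => ρ (0, q)) f ft fx fy)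
    (hε : 0 < ε) (hε1 : ε ≤ 1) {h t : ℝ} (hh : 0 < h) (ht : 0 ≤ t) (hth : t + h ≤ T) :
    ∃ D, HasDerivAt (correctedEnergy ε Lam h a ρ ρx ρy f) D t ∧
      D ≤ ε ^ 2 * (∫ p in phaseBox,
        (a (p.1, p.2.1) * (velocityFluxDeriv a ax ay ρx ρy ρxx ρxy ρyy t p -
          ρt (t, p.1, p.2.1)) ^ 2 + velocityFlux a ρx ρy (t, p) ^ 2)) +
      ε * ∫ p in phaseBox, ft (t, p) * (timeAverage h (velocityFlux a ρx ρy) (t, p) -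
        velocityFlux a ρx ρy (t, p)) := by
  have cf := K.cont
  have cft := K.cont_t
  have cρ := H.cont
  have cρt := H.cont_t
  have cW := H.continuous_velocityFlux
  have cV := continuous_timeAverage cW h
  have htT : t ∈ Set.Icc 0 T := ⟨ht, by linarith⟩
  have hthT : t + h ∈ Set.Icc 0 T := ⟨by linarith, hth⟩
  have d1 := hasDerivAt_integral_phaseBox
    (F := fun q => (f q - ρ (q.1, q.2.1, q.2.2.1)) ^ 2 / 2)
    (F' := fun q => (f q - ρ (q.1, q.2.1, q.2.2.1)) * (ft q - ρt (q.1, q.2.1, q.2.2.1)))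
    (by fun_prop) (by fun_prop) (fun t p => by
      refine ((((K.deriv_t t p).sub (H.deriv_t t (p.1, p.2.1))).pow 2).div_const 2).congr_deriv ?_
      simp only [Pi.sub_apply]
      ring) t
  have d2 := hasDerivAt_integral_phaseBox
    (F := fun q => f q * timeAverage h (velocityFlux a ρx ρy) q)
    (F' := fun q => ft q * timeAverage h (velocityFlux a ρx ρy) q + f q *
      (h⁻¹ * (velocityFlux a ρx ρy (q.1 + h, q.2) - velocityFlux a ρx ρy (q.1, q.2))))
    (by fun_prop) (by fun_prop)
    (fun t p => (K.deriv_t t p).mul (hasDerivAt_timeAverage cW h t p)) t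
  have d3 := hasDerivAt_integral_phaseBox
    (F := fun q => (h⁻¹ * (ρ (q.1 + h, q.2.1, q.2.2.1) - ρ (q.1, q.2.1, q.2.2.1))) ^ 2 / 2)
    (F' := fun q => (h⁻¹ * (ρ (q.1 + h, q.2.1, q.2.2.1) - ρ (q.1, q.2.1, q.2.2.1))) *
      (h⁻¹ * (ρt (q.1 + h, q.2.1, q.2.2.1) - ρt (q.1, q.2.1, q.2.2.1))))
    (by fun_prop) (by fun_prop) (fun t p => by
      refine ((((((H.deriv_t (t + h) (p.1, p.2.1)).comp_add_const t h).sub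
        (H.deriv_t t (p.1, p.2.1))).const_mul h⁻¹).pow 2).div_const 2).congr_deriv ?_
      simp only [Pi.sub_apply]
      ring) t
  refine ⟨_, (d1.add (d2.const_mul ε)).add (d3.const_mul (ε ^ 2 * ((Lam ^ 2 + Lam) / 2))), ?_⟩
  have hf := K.transportDeriv t
  refine corrected_energy_rate_le hε hε1 H.cont_a H.a_pos H.le_Lam
    (φ := velocityMean fun p => f (t, p)) (r := fun q => ρ (t, q)) (ρt := fun q => ρt (t, q))
    (ω := fun q => h⁻¹ * (ρ (t + h, q) - ρ (t, q)))
    (ωt := fun q => h⁻¹ * (ρt (t + h, q) - ρt (t, q)))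
    (g := fun p => f (t, p) - velocityMean (fun p => f (t, p)) (p.1, p.2.1))
    (continuous_velocityMean hf.cont) (by fun_prop) (by fun_prop) ?_ hf
    (H.transportDeriv t) (H.transportDeriv_flux t) (fun p => rfl) (fun p => by ring)
    (K.transport t htT) (velocityMeanZero_sub_mean hf.cont)
    (velocityMeanZero_velocityFlux a ρx ρy t) (velocityMeanZero_velocityGrad ρx ρy t)
    (H.meanZero_fluxDeriv_sub htT) (by fun_prop) (by fun_prop)
    (((H.transportDeriv (t + h)).sub (H.transportDeriv t)).const_mul h⁻¹)
    (((H.transportDeriv_flux (t + h)).sub (H.transportDeriv_flux t)).const_mul h⁻¹)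
    (fun p => by simp only [velocityFlux]; ring) ?_ ?_
  · have := continuous_velocityMean hf.cont
    fun_prop
  · exact ((velocityMeanZero_velocityFlux a ρx ρy (t + h)).sub (by fun_prop) (by fun_prop)
      (velocityMeanZero_velocityFlux a ρx ρy t)).const_mul h⁻¹
  · convert ((H.meanZero_fluxDeriv_sub hthT).sub ?_ ?_
      (H.meanZero_fluxDeriv_sub htT)).const_mul h⁻¹ using 2 with p
    · ring
    · have := (H.transportDeriv_flux (t + h)).cont_deriv
      fun_prop
    · have := (H.transportDeriv_flux t).cont_deriv
      fun_prop

lemma correctedEnergy_zero_le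
    (H : IsHeatFlow T lam Lam a ax ay ρ ρt ρx ρy ρxx ρxy ρyy)
    (K : IsKineticSolution T ε a (fun q => ρ (0, q)) f ft fx fy) {h M : ℝ}
    (hh : 0 < h) (hhT : h ≤ T) (hM : ∀ t ∈ Set.Icc 0 T, ∀ p ∈ phaseBox, |ρt (t, p.1, p.2.1)| ≤ M) :
    correctedEnergy ε Lam h a ρ ρx ρy f 0 ≤
      ε ^ 2 * ((Lam ^ 2 + Lam) / 2) * (2 * π * (M ^ 2 / 2)) := by
  have cρ := H.cont
  have cV := continuous_timeAverage H.continuous_velocityFlux h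
  have hLam : 0 < Lam := (H.a_pos 0).trans_le (H.le_Lam 0)
  have z := (velocityMeanZero_timeAverage_flux a H.cont_x H.cont_y h 0).integral_mul_eq_zero
    (by fun_prop) (φ := fun q => ρ (0, q)) (by fun_prop)
  simp only [correctedEnergy, K.init, z, sub_self]
  simp only [ne_eq, OfNat.ofNat_ne_zero, not_false_eq_true, zero_pow, zero_div, integral_zero,
    mul_zero, add_zero, zero_add]
  gcongr
  refine integral_phaseBox_le (by fun_prop) fun p hp => ?_
  have hb : |ρ (h, p.1, p.2.1) - ρ (0, p.1, p.2.1)| ≤ M * h := by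
    have := (convex_Icc 0 T).norm_image_sub_le_of_norm_hasDerivWithin_le
      (f := fun s => ρ (s, p.1, p.2.1)) (fun s hs => (H.deriv_t s (p.1, p.2.1)).hasDerivWithinAt)
      (fun s hs => hM s hs p hp) (⟨le_rfl, hh.le.trans hhT⟩ : (0 : ℝ) ∈ Set.Icc 0 T)
      (⟨hh.le, hhT⟩ : h ∈ Set.Icc 0 T)
    simpa [Real.norm_eq_abs, abs_of_pos hh] using this
  have : |h⁻¹ * (ρ (h, p.1, p.2.1) - ρ (0, p.1, p.2.1))| ≤ M := by
    rw [abs_mul, abs_of_pos (inv_pos.2 hh), inv_mul_le_iff₀ hh, mul_comm]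
    exact hb
  have := sq_le_sq' (abs_le.1 this).1 (abs_le.1 this).2
  linarith

lemma integral_sq_error_le_correctedEnergy
    (H : IsHeatFlow T lam Lam a ax ay ρ ρt ρx ρy ρxx ρxy ρyy)
    (K : IsKineticSolution T ε a (fun q => ρ (0, q)) f ft fx fy) {h t M : ℝ}
    (hh : 0 < h) (ht : 0 ≤ t) (hth : t + h ≤ T)
    (hM : ∀ t ∈ Set.Icc 0 T, ∀ p ∈ phaseBox, |velocityFlux a ρx ρy (t, p)| ≤ M) :
    (∫ p in phaseBox, (f (t, p) - ρ (t, p.1, p.2.1)) ^ 2) / 4 ≤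
      correctedEnergy ε Lam h a ρ ρx ρy f t + ε ^ 2 * (2 * π * M ^ 2) := by
  have cρ := H.cont
  have cf := K.cont
  have cV := continuous_timeAverage H.continuous_velocityFlux h
  have hLam : 0 < Lam := (H.a_pos 0).trans_le (H.le_Lam 0)
  have z := (velocityMeanZero_timeAverage_flux a H.cont_x H.cont_y h t).integral_mul_eq_zero
    (by fun_prop) (φ := fun q => ρ (t, q)) (by fun_prop)
  have hQ : 0 ≤ ε ^ 2 * ((Lam ^ 2 + Lam) / 2) * ∫ p : ℝ × ℝ × ℝ in phaseBox,
      (h⁻¹ * (ρ (t + h, p.1, p.2.1) - ρ (t, p.1, p.2.1))) ^ 2 / 2 :=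
    mul_nonneg (by positivity) (setIntegral_nonneg measurableSet_phaseBox fun _ _ => by positivity)
  have hV : ∫ p in phaseBox, timeAverage h (velocityFlux a ρx ρy) (t, p) ^ 2 ≤
      2 * π * M ^ 2 := by
    refine integral_phaseBox_le (by fun_prop) fun p hp => ?_
    have := abs_timeAverage_sub_le H.continuous_velocityFlux (c := 0) (δ := M) (p := p) hh
      fun s hs => by simpa using hM s ⟨ht.trans hs.1, hs.2.trans hth⟩ p hp
    rw [sub_zero] at this
    exact sq_le_sq' (abs_le.1 this).1 (abs_le.1 this).2
  have hY : 0 ≤ (∫ p in phaseBox, (f (t, p) - ρ (t, p.1, p.2.1)) ^ 2 / 2) -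
      (∫ p in phaseBox, (f (t, p) - ρ (t, p.1, p.2.1)) ^ 2) / 4 +
      ε * ((∫ p in phaseBox, f (t, p) * timeAverage h (velocityFlux a ρx ρy) (t, p)) -
        ∫ p in phaseBox, ρ (t, p.1, p.2.1) * timeAverage h (velocityFlux a ρx ρy) (t, p)) +
      ε ^ 2 * ∫ p in phaseBox, timeAverage h (velocityFlux a ρx ρy) (t, p) ^ 2 := by
    rw [← integral_div, ← integral_sub (Continuous.integrableOn_phaseBox (by fun_prop))
      (Continuous.integrableOn_phaseBox (by fun_prop)),
      ← integral_sub (Continuous.integrableOn_phaseBox (by fun_prop))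
      (Continuous.integrableOn_phaseBox (by fun_prop)), ← integral_const_mul, ← integral_const_mul,
      ← integral_add (Continuous.integrableOn_phaseBox (by fun_prop))
      (Continuous.integrableOn_phaseBox (by fun_prop)),
      ← integral_add (Continuous.integrableOn_phaseBox (by fun_prop))
      (Continuous.integrableOn_phaseBox (by fun_prop))]
    refine setIntegral_nonneg measurableSet_phaseBox fun p _ => ?_
    nlinarith [sq_nonneg ((f (t, p) - ρ (t, p.1, p.2.1)) / 2 +
      ε * timeAverage h (velocityFlux a ρx ρy) (t, p))]
  have := mul_le_mul_of_nonneg_left hV (sq_nonneg ε)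
  unfold correctedEnergy
  rw [z] at hY
  linarith

/-- The error estimate with a constant that depends only on the heat flow. -/
lemma exists_integral_sq_error_le
    (H : IsHeatFlow T lam Lam a ax ay ρ ρt ρx ρy ρxx ρxy ρyy) (hT : 0 < T) :
    ∃ C, 0 ≤ C ∧ ∀ ε, 0 < ε → ε ≤ 1 → ∀ f ft fx fy,
      IsKineticSolution T ε a (fun q => ρ (0, q)) f ft fx fy → ∀ t ∈ Set.Icc 0 T,
        ∫ p in phaseBox, (f (t, p) - ρ (t, p.1, p.2.1)) ^ 2 ≤ C * ε ^ 2 := by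
  have cW := H.continuous_velocityFlux
  have cρ := H.cont
  have cρt := H.cont_t
  have hLam : 0 < Lam := (H.a_pos 0).trans_le (H.le_Lam 0)
  obtain ⟨C₁, hC₁, b₁⟩ := H.exists_source_bound
  obtain ⟨C₂, hC₂, b₂⟩ := exists_bound_on_phaseBox T cW
  obtain ⟨C₃, hC₃, b₃⟩ := exists_bound_on_phaseBox T
    (F := fun q => ρt (q.1, q.2.1, q.2.2.1)) (by fun_prop)
  refine ⟨4 * (2 * π * C₂ ^ 2 + (Lam ^ 2 + Lam) / 2 * (2 * π * (C₃ ^ 2 / 2)) + (C₁ + 1) * T),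
    by positivity, fun ε hε hε1 f ft fx fy K => ?_⟩
  have cf := K.cont
  have cft := K.cont_t
  have hcont : Continuous fun t => ∫ p in phaseBox, (f (t, p) - ρ (t, p.1, p.2.1)) ^ 2 :=
    continuous_iff_continuousAt.2 fun t => (hasDerivAt_integral_phaseBox
      (F := fun q => (f q - ρ (q.1, q.2.1, q.2.2.1)) ^ 2)
      (F' := fun q => 2 * (f q - ρ (q.1, q.2.1, q.2.2.1)) * (ft q - ρt (q.1, q.2.1, q.2.2.1)))
      (by fun_prop) (by fun_prop) (fun t p => by
        refine (((K.deriv_t t p).sub (H.deriv_t t (p.1, p.2.1))).pow 2).congr_deriv ?_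
        simp only [Pi.sub_apply]
        ring) t).continuousAt
  intro t ht
  have hcl : t ∈ closure (Set.Ico 0 T) := by rwa [closure_Ico hT.ne]
  refine le_of_tendsto_of_frequently (hcont.tendsto t)
    ((mem_closure_iff_frequently.1 hcl).mono fun τ hτ => ?_)
  obtain ⟨M, hM, bM⟩ := exists_bound_on_phaseBox T cft
  set δ := ε / (2 * π * (M + 1)) with hδ
  have hδ0 : 0 < δ := by positivity
  obtain ⟨η, hη, bη⟩ := exists_time_modulus T cW hδ0
  set h := min (η / 2) (T - τ) with hh
  have hh0 : 0 < h := lt_min (by positivity) (by linarith [hτ.2])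
  have hhT : τ + h ≤ T := by linarith [min_le_right (η / 2) (T - τ)]
  have hhη : h < η := (min_le_left _ _).trans_lt (by linarith)
  have hrate : ∀ s ∈ Set.Icc 0 τ, ∃ D, HasDerivAt (correctedEnergy ε Lam h a ρ ρx ρy f) D s ∧
      D ≤ ε ^ 2 * (C₁ + 1) := by
    intro s hs
    obtain ⟨D, hD, hle⟩ := exists_hasDerivAt_correctedEnergy H K hε hε1 hh0 hs.1
      (by linarith [hs.2] : s + h ≤ T)
    refine ⟨D, hD, hle.trans ?_⟩
    have hsT : s ∈ Set.Icc 0 T := ⟨hs.1, by linarith [hs.2]⟩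
    have cV := continuous_timeAverage cW h
    have hr : ∫ p in phaseBox, ft (s, p) * (timeAverage h (velocityFlux a ρx ρy) (s, p) -
        velocityFlux a ρx ρy (s, p)) ≤ 2 * π * (M * δ) := by
      refine integral_phaseBox_le (by fun_prop) fun p hp => (le_abs_self _).trans ?_
      rw [abs_mul]
      refine mul_le_mul (bM s hsT p hp) (abs_timeAverage_sub_le cW hh0 fun r hr => ?_)
        (abs_nonneg _) hM
      refine bη r ⟨hs.1.trans hr.1, by linarith [hr.2, hs.2]⟩ s hsT ?_ p hp
      rw [abs_of_nonneg (by linarith [hr.1])]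
      linarith [hr.2]
    have hr' : 2 * π * (M * δ) ≤ ε := by
      have : 2 * π * ((M + 1) * δ) = ε := by rw [hδ]; field_simp
      have : 0 ≤ 2 * π * δ := by positivity
      linarith
    have h1 := mul_le_mul_of_nonneg_left (b₁ s hsT) (sq_nonneg ε)
    have h2 := mul_le_mul_of_nonneg_left (hr.trans hr') hε.le
    linarith
  have hgrow : correctedEnergy ε Lam h a ρ ρx ρy f τ - correctedEnergy ε Lam h a ρ ρx ρy f 0 ≤
      ε ^ 2 * (C₁ + 1) * (τ - 0) := by
    refine (convex_Icc 0 τ).image_sub_le_mul_sub_of_deriv_le (fun s hs => ?_) (fun s hs => ?_)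
      (fun s hs => ?_) 0 ⟨le_rfl, hτ.1⟩ τ ⟨hτ.1, le_rfl⟩ hτ.1
    · obtain ⟨D, hD, _⟩ := hrate s hs
      exact hD.continuousAt.continuousWithinAt
    · obtain ⟨D, hD, _⟩ := hrate s (interior_subset hs)
      exact hD.differentiableAt.differentiableWithinAt
    · obtain ⟨D, hD, hle⟩ := hrate s (interior_subset hs)
      rwa [hD.deriv]
  have h0 := correctedEnergy_zero_le H K hh0 (by linarith [hτ.1]) b₃
  have hend := integral_sq_error_le_correctedEnergy H K hh0 hτ.1 hhT b₂
  have hτT : ε ^ 2 * (C₁ + 1) * τ ≤ ε ^ 2 * (C₁ + 1) * T := by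
    have := hτ.2.le
    gcongr
  linarith

end ErrorEstimate

lemma hasDerivAt_prodMk_left (x y : ℝ) : HasDerivAt (fun s : ℝ => (s, y)) ((1 : ℝ), (0 : ℝ)) x :=
  (hasDerivAt_id x).prodMk (hasDerivAt_const x y)

lemma hasDerivAt_prodMk_right (x y : ℝ) : HasDerivAt (fun s : ℝ => (x, s)) ((0 : ℝ), (1 : ℝ)) y :=
  (hasDerivAt_const y x).prodMk (hasDerivAt_id y)

lemma ContDiff.hasDerivAt_comp_curve {E : Type*} [NormedAddCommGroup E] [NormedSpace ℝ E]
    {G : E → ℝ} (hG : ContDiff ℝ 1 G) {c : ℝ → E} {v : E} {t : ℝ} (hc : HasDerivAt c v t) :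
    HasDerivAt (fun s => G (c s)) (fderiv ℝ G (c t) v) t :=
  (hG.differentiable one_ne_zero (c t)).hasFDerivAt.comp_hasDerivAt t hc

lemma ContDiff.continuous_fderiv_apply_const {E : Type*} [NormedAddCommGroup E] [NormedSpace ℝ E]
    {G : E → ℝ} (hG : ContDiff ℝ 1 G) (v : E) : Continuous fun q => fderiv ℝ G q v :=
  (hG.continuous_fderiv one_ne_zero).clm_apply continuous_const

/-- The first partial derivatives of a `C²` function on the plane have continuous partial
derivatives, with equal mixed ones. -/
lemma ContDiff.exists_hasDerivAt_partials {G : ℝ × ℝ → ℝ} (hG : ContDiff ℝ 2 G)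
    {gx gy : ℝ × ℝ → ℝ} (hx : ∀ x y, HasDerivAt (fun s => G (s, y)) (gx (x, y)) x)
    (hy : ∀ x y, HasDerivAt (fun s => G (x, s)) (gy (x, y)) y) :
    ∃ gxx gxy gyy : ℝ × ℝ → ℝ, Continuous gxx ∧ Continuous gxy ∧ Continuous gyy ∧
      (∀ x y, HasDerivAt (fun s => gx (s, y)) (gxx (x, y)) x) ∧
      (∀ x y, HasDerivAt (fun s => gx (x, s)) (gxy (x, y)) y) ∧
      (∀ x y, HasDerivAt (fun s => gy (s, y)) (gxy (x, y)) x) ∧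
      (∀ x y, HasDerivAt (fun s => gy (x, s)) (gyy (x, y)) y) := by
  have hG1 : ContDiff ℝ 1 G := hG.of_le one_le_two
  have hD : ContDiff ℝ 1 (fderiv ℝ G) := hG.fderiv_right (by norm_num)
  have ex : gx = fun q => fderiv ℝ G q (1, 0) := funext fun q =>
    (hx q.1 q.2).unique (hG1.hasDerivAt_comp_curve (hasDerivAt_prodMk_left q.1 q.2))
  have ey : gy = fun q => fderiv ℝ G q (0, 1) := funext fun q =>
    (hy q.1 q.2).unique (hG1.hasDerivAt_comp_curve (hasDerivAt_prodMk_right q.1 q.2))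
  have key : ∀ {c : ℝ → ℝ × ℝ} {v : ℝ × ℝ} {t : ℝ} (w : ℝ × ℝ), HasDerivAt c v t →
      HasDerivAt (fun s => fderiv ℝ G (c s) w) (fderiv ℝ (fderiv ℝ G) (c t) v w) t := by
    intro c v t w hc
    simpa using ((hD.differentiable one_ne_zero (c t)).hasFDerivAt.comp_hasDerivAt t hc).clm_apply
      (hasDerivAt_const t w)
  have hcont : ∀ v w : ℝ × ℝ, Continuous fun q => fderiv ℝ (fderiv ℝ G) q v w := fun v w =>
    ((hD.continuous_fderiv one_ne_zero).clm_apply continuous_const).clm_apply continuous_const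
  have hsymm : ∀ q, fderiv ℝ (fderiv ℝ G) q (0, 1) (1, 0) = fderiv ℝ (fderiv ℝ G) q (1, 0) (0, 1) :=
    fun q => hG.contDiffAt.isSymmSndFDerivAt (by simp) (0, 1) (1, 0)
  subst ex ey
  refine ⟨_, _, _, hcont (1, 0) (1, 0), hcont (1, 0) (0, 1), hcont (0, 1) (0, 1),
    fun x y => key _ (hasDerivAt_prodMk_left x y), fun x y => ?_,
    fun x y => key _ (hasDerivAt_prodMk_left x y), fun x y => key _ (hasDerivAt_prodMk_right x y)⟩
  exact hsymm (x, y) ▸ key (1, 0) (hasDerivAt_prodMk_right x y)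

/-- diffusion limit of the transport equation: for a smooth, periodic,
uniformly elliptic coefficient `a`, a smooth periodic initial datum `ρ₀`, and a spatially
periodic solution `ρ` of the heat equation `∂_t ρ = (1/2) ∇·(a ∇ρ)` with `ρ(0,·) = ρ₀`,
there is a constant `C > 0`, independent of `ε`, such that every `C¹`, spatially periodic,
`2π`-periodic-in-ξ solution `f` of the scaled transport equation
`ε a ∂_t f + a cos ξ ∂_x f + a sin ξ ∂_y f = (1/ε)(⟨f⟩_ξ - f)` on `[0,T]`
with velocity-independent initial data `f(0,x,ξ) = ρ₀(x)` satisfies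
`‖f(t,·,·) - ρ(t,·)‖_{L²(dx dξ/(2π))} ≤ C ε` for all `t ∈ [0,T]` and all `ε ∈ (0,1]`. -/
theorem diffusion_limit_transport
    (T : ℝ) (hT : 0 < T)
    (lam Lam : ℝ) (hlam : 0 < lam)
    (a : ℝ → ℝ → ℝ)
    (ha_smooth : ContDiff ℝ (⊤ : ℕ∞) fun q : ℝ × ℝ => a q.1 q.2)
    (ha_perx : ∀ x y, a (x + 1) y = a x y)
    (ha_pery : ∀ x y, a x (y + 1) = a x y)
    (ha_bd : ∀ x y, lam ≤ a x y ∧ a x y ≤ Lam)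
    (ρ₀ : ℝ → ℝ → ℝ)
    (hρ₀_smooth : ContDiff ℝ (⊤ : ℕ∞) fun q : ℝ × ℝ => ρ₀ q.1 q.2)
    (hρ₀_perx : ∀ x y, ρ₀ (x + 1) y = ρ₀ x y)
    (hρ₀_pery : ∀ x y, ρ₀ x (y + 1) = ρ₀ x y)
    (ρ : ℝ → ℝ → ℝ → ℝ)
    (hρ_C1 : ContDiff ℝ 1 fun q : ℝ × ℝ × ℝ => ρ q.1 q.2.1 q.2.2)
    (hρ_C2space : ∀ t, ContDiff ℝ 2 fun q : ℝ × ℝ => ρ t q.1 q.2)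
    (hρ_perx : ∀ t x y, ρ t (x + 1) y = ρ t x y)
    (hρ_pery : ∀ t x y, ρ t x (y + 1) = ρ t x y)
    (hρ_init : ∀ x y, ρ 0 x y = ρ₀ x y)
    (hρ_heat : ∀ t ∈ Set.Icc (0 : ℝ) T, ∀ x y,
      deriv (fun s => ρ s x y) t =
        (1 / 2) * (deriv (fun x' => a x' y * deriv (fun x'' => ρ t x'' y) x') x +
          deriv (fun y' => a x y' * deriv (fun y'' => ρ t x y'') y') y)) :
    ∃ C > 0, ∀ ε : ℝ, ε ∈ Set.Ioc (0 : ℝ) 1 →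
      ∀ f : ℝ → ℝ → ℝ → ℝ → ℝ,
        (ContDiff ℝ 1 fun q : ℝ × ℝ × ℝ × ℝ => f q.1 q.2.1 q.2.2.1 q.2.2.2) →
        (∀ t x y ξ, f t (x + 1) y ξ = f t x y ξ) →
        (∀ t x y ξ, f t x (y + 1) ξ = f t x y ξ) →
        (∀ t x y ξ, f t x y (ξ + 2 * π) = f t x y ξ) →
        (∀ t ∈ Set.Icc (0 : ℝ) T, ∀ x y ξ,
          ε * a x y * deriv (fun s => f s x y ξ) t +
            a x y * Real.cos ξ * deriv (fun x' => f t x' y ξ) x +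
            a x y * Real.sin ξ * deriv (fun y' => f t x y' ξ) y =
          ε⁻¹ * ((2 * π)⁻¹ * (∫ ζ in Set.Ioc (-π) π, f t x y ζ) - f t x y ξ)) →
        (∀ x y ξ, f 0 x y ξ = ρ₀ x y) →
        ∀ t ∈ Set.Icc (0 : ℝ) T,
          Real.sqrt (∫ x in Set.Icc (0 : ℝ) 1, ∫ y in Set.Icc (0 : ℝ) 1,
            (2 * π)⁻¹ * ∫ ξ in Set.Ioc (-π) π, (f t x y ξ - ρ t x y) ^ 2) ≤ C * ε := by
  have ha1 : ContDiff ℝ 1 fun q : ℝ × ℝ => a q.1 q.2 := ha_smooth.of_le (by exact_mod_cast le_top)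
  set α : ℝ × ℝ → ℝ := fun q => a q.1 q.2 with hα
  set r : ℝ × ℝ × ℝ → ℝ := fun q => ρ q.1 q.2.1 q.2.2 with hr
  have rx : ∀ t x y, HasDerivAt (fun s => r (t, s, y)) (fderiv ℝ r (t, x, y) (0, 1, 0)) x :=
    fun t x y => hρ_C1.hasDerivAt_comp_curve
      ((hasDerivAt_const x t).prodMk (hasDerivAt_prodMk_left x y))
  have ry : ∀ t x y, HasDerivAt (fun s => r (t, x, s)) (fderiv ℝ r (t, x, y) (0, 0, 1)) y :=
    fun t x y => hρ_C1.hasDerivAt_comp_curve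
      ((hasDerivAt_const y t).prodMk (hasDerivAt_prodMk_right x y))
  choose rxx rxy ryy cxx cxy cyy dxx dxy dyx dyy using fun t =>
    (hρ_C2space t).exists_hasDerivAt_partials
      (gx := fun q => fderiv ℝ r (t, q) (0, 1, 0)) (gy := fun q => fderiv ℝ r (t, q) (0, 0, 1))
      (rx t) (ry t)
  have rt : ∀ t q, HasDerivAt (fun s => r (s, q)) (fderiv ℝ r (t, q) (1, 0)) t := fun t q =>
    hρ_C1.hasDerivAt_comp_curve ((hasDerivAt_id t).prodMk (hasDerivAt_const t q))
  have dax : ∀ x y, HasDerivAt (fun s => α (s, y)) (fderiv ℝ α (x, y) (1, 0)) x := fun x y =>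
    ha1.hasDerivAt_comp_curve (hasDerivAt_prodMk_left x y)
  have day : ∀ x y, HasDerivAt (fun s => α (x, s)) (fderiv ℝ α (x, y) (0, 1)) y := fun x y =>
    ha1.hasDerivAt_comp_curve (hasDerivAt_prodMk_right x y)
  have H : IsHeatFlow T lam Lam α (fun q => fderiv ℝ α q (1, 0)) (fun q => fderiv ℝ α q (0, 1))
      r (fun q => fderiv ℝ r q (1, 0)) (fun q => fderiv ℝ r q (0, 1, 0))
      (fun q => fderiv ℝ r q (0, 0, 1)) rxx rxy ryy :=
    { lam_pos := hlam
      cont_a := ha1.continuous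
      cont_ax := ha1.continuous_fderiv_apply_const _
      cont_ay := ha1.continuous_fderiv_apply_const _
      deriv_ax := dax
      deriv_ay := day
      per_ax := ha_perx
      per_ay := ha_pery
      lam_le := fun q => (ha_bd q.1 q.2).1
      le_Lam := fun q => (ha_bd q.1 q.2).2
      cont := hρ_C1.continuous
      cont_t := hρ_C1.continuous_fderiv_apply_const _
      cont_x := hρ_C1.continuous_fderiv_apply_const _
      cont_y := hρ_C1.continuous_fderiv_apply_const _
      cont_xx := cxx
      cont_xy := cxy
      cont_yy := cyy
      deriv_t := rt
      deriv_x := rx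
      deriv_y := ry
      deriv_xx := dxx
      deriv_xy := dxy
      deriv_yx := dyx
      deriv_yy := dyy
      per_x := hρ_perx
      per_y := hρ_pery
      heat := by
        rintro t ht ⟨x, y⟩
        have h := hρ_heat t ht x y
        rw [(rt t (x, y)).deriv] at h
        have ex : ∀ s, deriv (fun x' => ρ t x' y) s = fderiv ℝ r (t, s, y) (0, 1, 0) :=
          fun s => (rx t s y).deriv
        have ey : ∀ s, deriv (fun y' => ρ t x y') s = fderiv ℝ r (t, x, s) (0, 0, 1) :=
          fun s => (ry t x s).deriv
        simp only [ex, ey] at h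
        exact h.trans (congrArg (1 / 2 * ·) (congrArg₂ (· + ·) ((dax x y).mul (dxx t x y)).deriv
          ((day x y).mul (dyy t x y)).deriv)) }
  obtain ⟨C, hC, hmain⟩ := exists_integral_sq_error_le H hT
  refine ⟨√((2 * π)⁻¹ * C) + 1, by positivity, fun ε hε f hf hfx hfy _ heq hinit t ht => ?_⟩
  set φ : ℝ × ℝ × ℝ × ℝ → ℝ := fun q => f q.1 q.2.1 q.2.2.1 q.2.2.2 with hφ
  have ft : ∀ t p, HasDerivAt (fun s => φ (s, p)) (fderiv ℝ φ (t, p) (1, 0)) t := fun t p =>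
    hf.hasDerivAt_comp_curve ((hasDerivAt_id t).prodMk (hasDerivAt_const t p))
  have fx : ∀ t x y ξ, HasDerivAt (fun s => φ (t, s, y, ξ))
      (fderiv ℝ φ (t, x, y, ξ) (0, 1, 0)) x := fun t x y ξ =>
    hf.hasDerivAt_comp_curve ((hasDerivAt_const x t).prodMk
      ((hasDerivAt_id x).prodMk (hasDerivAt_const x (y, ξ))))
  have fy : ∀ t x y ξ, HasDerivAt (fun s => φ (t, x, s, ξ))
      (fderiv ℝ φ (t, x, y, ξ) (0, 0, 1, 0)) y := fun t x y ξ =>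
    hf.hasDerivAt_comp_curve ((hasDerivAt_const y t).prodMk
      ((hasDerivAt_const y x).prodMk (hasDerivAt_prodMk_left y ξ)))
  have K : IsKineticSolution T ε α (fun q => r (0, q)) φ (fun q => fderiv ℝ φ q (1, 0))
      (fun q => fderiv ℝ φ q (0, 1, 0)) (fun q => fderiv ℝ φ q (0, 0, 1, 0)) :=
    { cont := hf.continuous
      cont_t := hf.continuous_fderiv_apply_const _
      cont_x := hf.continuous_fderiv_apply_const _
      cont_y := hf.continuous_fderiv_apply_const _
      deriv_t := ft
      deriv_x := fx
      deriv_y := fy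
      per_x := hfx
      per_y := hfy
      init := fun p => (hinit p.1 p.2.1 p.2.2).trans (hρ_init p.1 p.2.1).symm
      transport := by
        rintro t ht ⟨x, y, ξ⟩
        have h := heq t ht x y ξ
        rw [(ft t (x, y, ξ)).deriv, (fx t x y ξ).deriv, (fy t x y ξ).deriv] at h
        simp only [velocityMean, hα, hφ] at h ⊢
        linear_combination h }
  have hle := hmain ε hε.1 hε.2 φ _ _ _ K t ht
  have hφc : Continuous φ := hf.continuous
  have hrc : Continuous r := hρ_C1.continuous
  rw [integral_phaseBox_eq (by fun_prop)] at hle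
  simp only [integral_const_mul]
  calc _ ≤ √((2 * π)⁻¹ * (C * ε ^ 2)) :=
        Real.sqrt_le_sqrt (mul_le_mul_of_nonneg_left hle (by positivity))
    _ = √((2 * π)⁻¹ * C) * ε := by
        rw [← mul_assoc, Real.sqrt_mul (by positivity), Real.sqrt_sq hε.1.le]
    _ ≤ _ := by nlinarith [hε.1]
end

section
/- (1D multiscale finite element basis is O(δ)-close to the hat basis.) Let M ≥ 2, H = 1/M, and x_m = mH for m = 0, …, M (periodic grid on [0,1]). Let A : ℝ → ℝ be continuous, 1-periodic, with 0 < λ ≤ A(y) ≤ Λ, let δ ∈ (0, H], and set a(x) = A(x/δ). Define the multiscale basis function φ_m supported on [x_{m−1}, x_{m+1}] by φ_m(x) = (∫_{x_{m−1}}^{x} a(s)⁻¹ ds)/(∫_{x_{m−1}}^{x_m} a(s)⁻¹ ds) for x ∈ [x_{m−1}, x_m] and φ_m(x) = (∫_{x}^{x_{m+1}} a(s)⁻¹ ds)/(∫_{x_m}^{x_{m+1}} a(s)⁻¹ ds) for x ∈ [x_m, x_{m+1}] (this is the a-harmonic function with nodal values φ_m(x_m) = 1, φ_m(x_{m±1})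 = 0), and let φ̄_m be the piecewise-linear hat function with the same nodal values on the same support. Then there exists a constant C depending only on λ and Λ such that sup_{x ∈ [0,1]} |φ_m(x) − φ̄_m(x)| ≤ C δ / H for every m. -/
open MeasureTheory intervalIntegral

/-- Inverse-coefficient integral over the grid cell to the right of node `x_m = mH`
(on the periodic unit interval, parametrized by `Int.fract (· - mH)`). -/
noncomputable def msCellR (a : ℝ → ℝ) (H : ℝ) (m : ℕ) : ℝ :=
  ∫ s in (0 : ℝ)..1, if Int.fract (s - m * H) < H then (a s)⁻¹ else 0

/-- Inverse-coefficient integral over the grid cell to the left of node `x_m = mH`. -/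
noncomputable def msCellL (a : ℝ → ℝ) (H : ℝ) (m : ℕ) : ℝ :=
  ∫ s in (0 : ℝ)..1, if 1 - H ≤ Int.fract (s - m * H) then (a s)⁻¹ else 0

/-- The 1D multiscale finite element basis function attached to the node `x_m = mH` of the
periodic grid: the `a`-harmonic function on each adjacent cell with nodal values
`φ_m(x_m) = 1`, `φ_m(x_{m±1}) = 0`, i.e. `φ_m(x) = (∫_{x_{m-1}}^x a⁻¹)/(∫_{x_{m-1}}^{x_m} a⁻¹)`
on the left cell and `φ_m(x) = (∫_x^{x_{m+1}} a⁻¹)/(∫_{x_m}^{x_{m+1}} a⁻¹)` on the right cell,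
written in periodic coordinates. -/
noncomputable def msPhi (a : ℝ → ℝ) (H : ℝ) (m : ℕ) (x : ℝ) : ℝ :=
  if Int.fract (x - m * H) < H then
    (∫ s in (0 : ℝ)..1,
        if Int.fract (x - m * H) ≤ Int.fract (s - m * H) ∧ Int.fract (s - m * H) < H then
          (a s)⁻¹ else 0) / msCellR a H m
  else if 1 - H ≤ Int.fract (x - m * H) then
    (∫ s in (0 : ℝ)..1,
        if 1 - H ≤ Int.fract (s - m * H) ∧ Int.fract (s - m * H) ≤ Int.fract (x - m * H) then
          (a s)⁻¹ else 0) / msCellL a H m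
  else 0

/-- The piecewise-linear hat function attached to the node `x_m = mH` of the periodic grid,
with the same nodal values as `msPhi`. -/
noncomputable def hatPhi (H : ℝ) (m : ℕ) (x : ℝ) : ℝ :=
  if Int.fract (x - m * H) < H then 1 - Int.fract (x - m * H) / H
  else if 1 - H ≤ Int.fract (x - m * H) then (Int.fract (x - m * H) - (1 - H)) / H
  else 0

theorem intervalIntegral_mem_Icc {h : ℝ → ℝ} (hh : Continuous h) {k K : ℝ}
    (hk : ∀ y, k ≤ h y) (hK : ∀ y, h y ≤ K) {u v : ℝ} (huv : u ≤ v) :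
    k * (v - u) ≤ ∫ y in u..v, h y ∧ ∫ y in u..v, h y ≤ K * (v - u) := by
  have h1 := integral_mono_on (μ := volume) huv (intervalIntegrable_const (c := k))
    (hh.intervalIntegrable u v) (fun y _ => hk y)
  have h2 := integral_mono_on (μ := volume) huv (hh.intervalIntegrable u v)
    (intervalIntegrable_const (c := K)) (fun y _ => hK y)
  simp only [intervalIntegral.integral_const, smul_eq_mul] at h1 h2
  constructor <;> linarith

theorem Function.Periodic.abs_intervalIntegral_sub_mean_le {h : ℝ → ℝ} (hh : Continuous h)
    (hper : Function.Periodic h 1) {K : ℝ} (h0 : ∀ y, 0 ≤ h y) (hK : ∀ y, h y ≤ K) (u v : ℝ) :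
    |(∫ y in u..v, h y) - (∫ y in (0 : ℝ)..1, h y) * (v - u)| ≤ K := by
  have hn : ∫ y in u..(u + ⌊v - u⌋), h y = ⌊v - u⌋ * ∫ y in (0 : ℝ)..1, h y := by
    have := hper.intervalIntegral_add_zsmul_eq ⌊v - u⌋ u (fun a b => hh.intervalIntegrable a b)
    rw [zsmul_eq_mul, mul_one, zsmul_eq_mul, hper.intervalIntegral_add_eq u 0, zero_add] at this
    exact this
  have hadd := integral_add_adjacent_intervals (hh.intervalIntegrable (μ := volume) u (u + ⌊v - u⌋))
    (hh.intervalIntegrable (u + ⌊v - u⌋) v)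
  have hf0 := Int.floor_le (v - u)
  have hf1 := (Int.lt_floor_add_one (v - u)).le
  have hrest := intervalIntegral_mem_Icc hh h0 hK (u := u + ⌊v - u⌋) (v := v) (by linarith)
  have hmean := intervalIntegral_mem_Icc hh h0 hK (zero_le_one (α := ℝ))
  have hK0 : 0 ≤ K := (h0 0).trans (hK 0)
  rw [← hadd, hn, abs_le]
  constructor <;> nlinarith

theorem abs_intervalIntegral_comp_div_sub_mean_le {h : ℝ → ℝ} (hh : Continuous h)
    (hper : Function.Periodic h 1) {K : ℝ} (h0 : ∀ y, 0 ≤ h y) (hK : ∀ y, h y ≤ K)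
    {δ : ℝ} (hδ : 0 < δ) (p q : ℝ) :
    |(∫ s in p..q, h (s / δ)) - (∫ y in (0 : ℝ)..1, h y) * (q - p)| ≤ K * δ := by
  have key := hper.abs_intervalIntegral_sub_mean_le hh h0 hK (p / δ) (q / δ)
  rw [intervalIntegral.integral_comp_div h hδ.ne', smul_eq_mul]
  have heq : δ * (∫ y in p / δ..q / δ, h y) - (∫ y in (0 : ℝ)..1, h y) * (q - p) =
      δ * ((∫ y in p / δ..q / δ, h y) - (∫ y in (0 : ℝ)..1, h y) * (q / δ - p / δ)) := by
    field_simp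
  rw [heq, abs_mul, abs_of_pos hδ, mul_comm]
  gcongr

theorem Int.fract_sub_eq_ite (s c : ℝ) (hs0 : 0 ≤ s) (hs1 : s < 1) :
    Int.fract (s - c) =
      if Int.fract c ≤ s then s - Int.fract c else s - Int.fract c + 1 := by
  have hr0 := Int.fract_nonneg c
  have hr1 := Int.fract_lt_one c
  have hc := Int.floor_add_fract c
  split_ifs with hle
  · exact Int.fract_eq_iff.2 ⟨by linarith, by linarith, -⌊c⌋, by push_cast; linarith⟩
  · exact Int.fract_eq_iff.2 ⟨by linarith, by linarith, -⌊c⌋ - 1, by push_cast; linarith⟩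

open Classical in
/-- The integral over an arc of the periodic unit interval is a sum of two interval integrals. -/
theorem exists_integral_arc_eq {g : ℝ → ℝ} (hg : Continuous g) (c : ℝ) {α β : ℝ}
    (hα : 0 ≤ α) (hαβ : α ≤ β) (hβ : β ≤ 1) (P : ℝ → Prop)
    (hP : ∀ y, 0 ≤ y → y < 1 → α < y → y < β → P y)
    (hP' : ∀ y, 0 ≤ y → y < 1 → P y → α ≤ y ∧ y ≤ β) :
    ∃ p q p' q' : ℝ, p ≤ q ∧ p' ≤ q' ∧ (q - p) + (q' - p') = β - α ∧
      ∫ s in (0 : ℝ)..1, (if P (Int.fract (s - c)) then g s else 0) =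
        (∫ s in p..q, g s) + ∫ s in p'..q', g s := by
  set r := Int.fract c with hr
  have hr0 : 0 ≤ r := Int.fract_nonneg c
  have hr1 : r < 1 := Int.fract_lt_one c
  have hsplit : ∀ t : ℝ, min 1 t + max 0 (t - 1) = t := fun t => by
    rcases le_total 1 t with h | h
    · rw [min_eq_left h, max_eq_right (by linarith)]; ring
    · rw [min_eq_right h, max_eq_left (by linarith)]; ring
  have hpq : min 1 (r + α) ≤ min 1 (r + β) := by gcongr
  have hpq' : max 0 (r + α - 1) ≤ max 0 (r + β - 1) := by gcongr
  refine ⟨min 1 (r + α), min 1 (r + β), max 0 (r + α - 1), max 0 (r + β - 1), hpq, hpq',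
    by linarith [hsplit (r + α), hsplit (r + β)], ?_⟩
  have hae : ∀ᵐ s : ℝ, s ∈ Set.uIoc (0 : ℝ) 1 →
      (if P (Int.fract (s - c)) then g s else 0) =
        (Set.Ioc (min 1 (r + α)) (min 1 (r + β))).indicator g s +
        (Set.Ioc (max 0 (r + α - 1)) (max 0 (r + β - 1))).indicator g s := by
    have hfin : ({1, r + α, r + β, r + α - 1, r + β - 1} : Set ℝ).Countable :=
      (Set.toFinite _).countable
    filter_upwards [hfin.ae_notMem volume] with s hs hs01
    rw [Set.uIoc_of_le zero_le_one] at hs01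
    simp only [Set.mem_insert_iff, Set.mem_singleton_iff, not_or] at hs
    obtain ⟨hs1, hsα, hsβ, hsα', hsβ'⟩ := hs
    have hs1' : s < 1 := lt_of_le_of_ne hs01.2 hs1
    have hfr := Int.fract_sub_eq_ite s c hs01.1.le hs1'
    have hy0 := Int.fract_nonneg (s - c)
    have hy1 := Int.fract_lt_one (s - c)
    have hPiff : P (Int.fract (s - c)) ↔
        α < Int.fract (s - c) ∧ Int.fract (s - c) < β := by
      refine ⟨fun h => ?_, fun h => hP _ hy0 hy1 h.1 h.2⟩
      obtain ⟨h1, h2⟩ := hP' _ hy0 hy1 h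
      rw [← hr] at hfr
      refine ⟨lt_of_le_of_ne h1 fun h => ?_, lt_of_le_of_ne h2 fun h => ?_⟩
      · split_ifs at hfr
        · exact hsα (by linarith)
        · exact hsα' (by linarith)
      · split_ifs at hfr
        · exact hsβ (by linarith)
        · exact hsβ' (by linarith)
    simp only [Set.indicator_apply, Set.mem_Ioc, min_lt_iff, max_lt_iff, le_min_iff, le_max_iff,
      hPiff]
    rw [← hr] at hfr
    have := hs01.1
    grind
  have hint : ∀ x y : ℝ, IntervalIntegrable ((Set.Ioc x y).indicator g) volume 0 1 := fun x y =>
    ((intervalIntegrable_iff_integrableOn_Ioc_of_le zero_le_one).2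
      (((hg.intervalIntegrable 0 1).1).indicator measurableSet_Ioc))
  have hind : ∀ x y : ℝ, 0 ≤ x → x ≤ y → y ≤ 1 →
      ∫ s in (0 : ℝ)..1, (Set.Ioc x y).indicator g s = ∫ s in x..y, g s := fun x y hx hxy hy => by
    rw [integral_of_le zero_le_one, setIntegral_indicator measurableSet_Ioc,
      integral_of_le hxy, Set.inter_eq_right.2 (Set.Ioc_subset_Ioc hx hy)]
  rw [integral_congr_ae hae, intervalIntegral.integral_add (hint _ _) (hint _ _),
    hind _ _ (le_min zero_le_one (by linarith)) hpq (min_le_left _ _),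
    hind _ _ (le_max_left _ _) hpq' (max_le zero_le_one (by linarith))]

theorem abs_div_sub_div_le {N D θ w H E d : ℝ} (hw0 : 0 ≤ w) (hwH : w ≤ H) (hd : 0 < d)
    (hH : 0 < H) (hN : |N - θ * w| ≤ E) (hD : |D - θ * H| ≤ E) (hdD : d * H ≤ D) :
    |N / D - w / H| ≤ 2 * E / (d * H) := by
  have hdH : 0 < d * H := mul_pos hd hH
  have hDpos : 0 < D := hdH.trans_le hdD
  have hE : 0 ≤ E := (abs_nonneg _).trans hN
  have heq : N / D - w / H = ((N - θ * w) - w / H * (D - θ * H)) / D := by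
    field_simp
    ring
  have hwH' : w / H ≤ 1 := (div_le_one hH).2 hwH
  have hnum : |(N - θ * w) - w / H * (D - θ * H)| ≤ 2 * E := by
    refine (abs_sub _ _).trans ?_
    rw [abs_mul, abs_of_nonneg (div_nonneg hw0 hH.le)]
    nlinarith [abs_nonneg (D - θ * H)]
  rw [heq, abs_div, abs_of_pos hDpos]
  gcongr

/-- Over an arc of length `β - α`, a rapidly oscillating periodic function integrates to its mean
times the length, up to the oscillation scale. -/
theorem integral_arc_comp_div_bounds {h : ℝ → ℝ} (hh : Continuous h)
    (hper : Function.Periodic h 1) {k K : ℝ} (hk0 : 0 ≤ k) (hk : ∀ y, k ≤ h y)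
    (hK : ∀ y, h y ≤ K) {δ : ℝ} (hδ : 0 < δ) (c : ℝ) {α β : ℝ}
    (hα : 0 ≤ α) (hαβ : α ≤ β) (hβ : β ≤ 1) (P : ℝ → Prop) [DecidablePred P]
    (hP : ∀ y, 0 ≤ y → y < 1 → α < y → y < β → P y)
    (hP' : ∀ y, 0 ≤ y → y < 1 → P y → α ≤ y ∧ y ≤ β) :
    |(∫ s in (0 : ℝ)..1, (if P (Int.fract (s - c)) then h (s / δ) else 0)) -
        (∫ y in (0 : ℝ)..1, h y) * (β - α)| ≤ 2 * K * δ ∧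
      k * (β - α) ≤ ∫ s in (0 : ℝ)..1, (if P (Int.fract (s - c)) then h (s / δ) else 0) := by
  have hg : Continuous fun s => h (s / δ) := hh.comp (continuous_id.div_const δ)
  obtain ⟨p, q, p', q', hpq, hpq', hlen, heq⟩ := exists_integral_arc_eq hg c hα hαβ hβ P hP hP'
  have heq' : ∫ s in (0 : ℝ)..1, (if P (Int.fract (s - c)) then h (s / δ) else 0) =
      (∫ s in p..q, h (s / δ)) + ∫ s in p'..q', h (s / δ) := by
    rw [← heq]
    congr!
  have h0 : ∀ y, 0 ≤ h y := fun y => hk0.trans (hk y)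
  have e1 := abs_le.1 (abs_intervalIntegral_comp_div_sub_mean_le hh hper h0 hK hδ p q)
  have e2 := abs_le.1 (abs_intervalIntegral_comp_div_sub_mean_le hh hper h0 hK hδ p' q')
  have b1 := (intervalIntegral_mem_Icc hg (fun s => hk _) (fun s => hK _) hpq).1
  have b2 := (intervalIntegral_mem_Icc hg (fun s => hk _) (fun s => hK _) hpq').1
  rw [heq', ← hlen]
  refine ⟨abs_le.2 ⟨?_, ?_⟩, ?_⟩ <;> linarith

/-- the 1D multiscale finite element basis is `O(δ/H)`-close to the hat basis:
for `a(x) = A(x/δ)` with `A` continuous, 1-periodic and `0 < λ ≤ A ≤ Λ`, `H = 1/M`, `M ≥ 2`,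
`δ ∈ (0,H]`, one has `sup_{x∈[0,1]} |φ_m(x) - φ̄_m(x)| ≤ C δ/H` for every node `m`, with `C`
depending only on `λ` and `Λ`. -/
theorem msfem_basis_close_to_hat (lam Lam : ℝ) (hlam : 0 < lam) (hlamLam : lam ≤ Lam) :
    ∃ C > 0, ∀ M : ℕ, 2 ≤ M → ∀ A : ℝ → ℝ, Continuous A → (∀ y, A (y + 1) = A y) →
      (∀ y, lam ≤ A y ∧ A y ≤ Lam) → ∀ H δ : ℝ, H = 1 / M → 0 < δ → δ ≤ H →
      ∀ (m : ℕ), ∀ x ∈ Set.Icc (0 : ℝ) 1,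
        |msPhi (fun t => A (t / δ)) H m x - hatPhi H m x| ≤ C * δ / H := by
  have hLam : 0 < Lam := hlam.trans_le hlamLam
  refine ⟨4 * Lam / lam, by positivity, ?_⟩
  intro M hM A hA hper hbd H δ hH hδ _ m x _
  have hM' : (2 : ℝ) ≤ M := by exact_mod_cast hM
  have hH0 : 0 < H := by rw [hH]; positivity
  have hH1 : H ≤ 1 := by
    rw [hH]
    exact (div_le_one (by linarith)).2 (by linarith)
  have hpos : ∀ y, 0 < A y := fun y => hlam.trans_le (hbd y).1
  have hh : Continuous fun y => (A y)⁻¹ := hA.inv₀ fun y => (hpos y).ne'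
  have hhper : Function.Periodic (fun y => (A y)⁻¹) 1 := fun y => by simp only [hper y]
  have hk : ∀ y, Lam⁻¹ ≤ (A y)⁻¹ := fun y => inv_anti₀ (hpos y) (hbd y).2
  have hK : ∀ y, (A y)⁻¹ ≤ lam⁻¹ := fun y => inv_anti₀ hlam (hbd y).1
  have hk0 : 0 < Lam⁻¹ := inv_pos.2 hLam
  have hC : 2 * (2 * lam⁻¹ * δ) / (Lam⁻¹ * H) = 4 * Lam / lam * δ / H := by
    field_simp
    ring
  have ht0 := Int.fract_nonneg (x - m * H)
  have ht1 := Int.fract_lt_one (x - m * H)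
  unfold msPhi hatPhi
  set t := Int.fract (x - m * H)
  rw [← hC]
  split_ifs with h1 h2
  · have hN := (integral_arc_comp_div_bounds hh hhper hk0.le hk hK hδ (m * H) ht0 h1.le hH1
      (fun y => t ≤ y ∧ y < H) (fun y _ _ ha hb => ⟨ha.le, hb⟩)
      (fun y _ _ h => ⟨h.1, h.2.le⟩)).1
    have hD := integral_arc_comp_div_bounds hh hhper hk0.le hk hK hδ (m * H) le_rfl hH0.le hH1
      (fun y => y < H) (fun y _ _ _ hb => hb) (fun y hy _ h => ⟨hy, h.le⟩)
    rw [sub_zero] at hD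
    have hhat : 1 - t / H = (H - t) / H := by field_simp
    rw [hhat]
    exact abs_div_sub_div_le (by linarith) (by linarith) hk0 hH0 hN hD.1 hD.2
  · have hN := (integral_arc_comp_div_bounds hh hhper hk0.le hk hK hδ (m * H)
      (by linarith : 0 ≤ 1 - H) h2 ht1.le
      (fun y => 1 - H ≤ y ∧ y ≤ t) (fun y _ _ ha hb => ⟨ha.le, hb.le⟩)
      (fun y _ _ h => h)).1
    have hD := integral_arc_comp_div_bounds hh hhper hk0.le hk hK hδ (m * H)
      (by linarith : 0 ≤ 1 - H) (by linarith) le_rfl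
      (fun y => 1 - H ≤ y) (fun y _ _ ha _ => ha.le) (fun y _ hy h => ⟨h, hy.le⟩)
    rw [sub_sub_cancel] at hD
    exact abs_div_sub_div_le (by linarith) (by linarith) hk0 hH0 hN hD.1 hD.2
  · rw [sub_zero, abs_zero]
    positivity
end

section
/- (1D convergence of the multiscale stiffness matrix to the homogenized stiffness matrix at rate O(δ).) Let M ≥ 2, H = 1/M, x_m = mH (periodic grid on [0,1]). Let A : ℝ → ℝ be continuous, 1-periodic, with 0 < λ ≤ A(y) ≤ Λ, let δ ∈ (0,H], and set a(x) = A(x/δ), and let a_hom = (∫₀¹ A(y)⁻¹ dy)⁻¹ be the harmonic mean. Let φ_m be the 1D multiscale basis functions (a-harmonic on each cell with nodal values φ_m(x_m) = 1, φ_m(x_{m±1}) = 0) and φ̄_m the corresponding hat functions. Define the stiffness matrices 𝔸_{nm} = −∫₀¹ a(x) φ_m′(x) φ_n′(x) dx and 𝔸hom_{nm} = −a_hom ∫₀¹ φ̄_m′(x) φ̄_n′(x) dx. Then there exists C depending only on λ and Λ such that |𝔸_{nm} − 𝔸hom_{nm}| ≤ C δ / H² for all m, n. -/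
open MeasureTheory intervalIntegral

/-- The piecewise derivative of the 1D multiscale basis function `φ_m` (the `a`-harmonic
function on each cell adjacent to the node `x_m = mH` with nodal values `φ_m(x_m) = 1`,
`φ_m(x_{m±1}) = 0`): `φ_m'(x) = a(x)⁻¹/∫_{x_{m-1}}^{x_m} a⁻¹` on the left cell and
`φ_m'(x) = -a(x)⁻¹/∫_{x_m}^{x_{m+1}} a⁻¹` on the right cell, in periodic coordinates. -/
noncomputable def msPsi (a : ℝ → ℝ) (H : ℝ) (m : ℕ) (x : ℝ) : ℝ :=
  if Int.fract (x - m * H) < H then -(a x)⁻¹ / msCellR a H m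
  else if 1 - H ≤ Int.fract (x - m * H) then (a x)⁻¹ / msCellL a H m
  else 0

/-- The piecewise derivative of the hat function attached to the node `x_m = mH`:
`1/H` on the left cell, `-1/H` on the right cell, `0` elsewhere. -/
noncomputable def hatPsi (H : ℝ) (m : ℕ) (x : ℝ) : ℝ :=
  if Int.fract (x - m * H) < H then -1 / H
  else if 1 - H ≤ Int.fract (x - m * H) then 1 / H
  else 0

theorem fract_sub_mul_eq {M : ℕ} (hM : 2 ≤ M) {H : ℝ} (hH : H = 1 / M) (m j : ℕ) {x : ℝ}
    (hx : x ∈ Set.Ico (j * H) ((j + 1) * H)) :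
    Int.fract (x - m * H) = (((j : ℤ) - m) % M : ℤ) * H + (x - j * H) := by
  have hM0 : (0 : ℝ) < M := by positivity
  have hMH : M * H = 1 := by rw [hH]; field_simp
  have hH0 : 0 < H := by rw [hH]; positivity
  have h0 : (0 : ℤ) ≤ ((j : ℤ) - m) % M := Int.emod_nonneg _ (by omega)
  have h1 : ((j : ℤ) - m) % M + 1 ≤ M := Int.emod_lt_of_pos _ (by omega)
  have h2 := Int.emod_add_mul_ediv ((j : ℤ) - m) M
  have h0' : (0 : ℝ) ≤ (((j : ℤ) - m) % M : ℤ) := by exact_mod_cast h0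
  have h1' : ((((j : ℤ) - m) % M : ℤ) : ℝ) + 1 ≤ M := by exact_mod_cast h1
  have h2' : ((((j : ℤ) - m) % M : ℤ) : ℝ) + M * ((((j : ℤ) - m) / M : ℤ) : ℝ) = j - m := by
    exact_mod_cast h2
  obtain ⟨hx0, hx1⟩ := hx
  rw [Int.fract_eq_iff]
  refine ⟨by nlinarith, by nlinarith, ((j : ℤ) - m) / M, ?_⟩
  linear_combination (-H) * h2' + ((((j : ℤ) - m) / M : ℤ) : ℝ) * hMH

theorem fract_sub_mul_lt_iff {M : ℕ} (hM : 2 ≤ M) {H : ℝ} (hH : H = 1 / M) (m j : ℕ) {x : ℝ}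
    (hx : x ∈ Set.Ico (j * H) ((j + 1) * H)) :
    Int.fract (x - m * H) < H ↔ ((j : ℤ) - m) % M = 0 := by
  have hH0 : 0 < H := by rw [hH]; positivity
  have h0 : (0 : ℤ) ≤ ((j : ℤ) - m) % M := Int.emod_nonneg _ (by omega)
  rw [fract_sub_mul_eq hM hH m j hx]
  obtain ⟨hx0, hx1⟩ := hx
  constructor
  · intro h
    by_contra hne
    have h1 : (1 : ℤ) ≤ ((j : ℤ) - m) % M := by omega
    have h1' : (1 : ℝ) ≤ (((j : ℤ) - m) % M : ℤ) := by exact_mod_cast h1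
    nlinarith
  · intro h
    rw [h]
    push_cast
    linarith

theorem one_sub_le_fract_sub_mul_iff {M : ℕ} (hM : 2 ≤ M) {H : ℝ} (hH : H = 1 / M) (m j : ℕ)
    {x : ℝ} (hx : x ∈ Set.Ico (j * H) ((j + 1) * H)) :
    1 - H ≤ Int.fract (x - m * H) ↔ ((j : ℤ) - m) % M = M - 1 := by
  have hM0 : (0 : ℝ) < M := by positivity
  have hMH : M * H = 1 := by rw [hH]; field_simp
  have hH0 : 0 < H := by rw [hH]; positivity
  have h1 : ((j : ℤ) - m) % M + 1 ≤ M := Int.emod_lt_of_pos _ (by omega)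
  rw [fract_sub_mul_eq hM hH m j hx]
  obtain ⟨hx0, hx1⟩ := hx
  constructor
  · intro h
    by_contra hne
    have h2 : ((j : ℤ) - m) % M + 2 ≤ M := by omega
    have h2' : ((((j : ℤ) - m) % M : ℤ) : ℝ) + 2 ≤ M := by exact_mod_cast h2
    nlinarith
  · intro h
    rw [h]
    push_cast
    linarith

/-- The nodal sign pattern of the derivative of the basis function at node `m` on cell `j`. -/
noncomputable def cellSign (M m j : ℕ) : ℝ :=
  if ((j : ℤ) - m) % M = 0 then -1 else if ((j : ℤ) - m) % M = M - 1 then 1 else 0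

theorem eq_of_sub_emod_eq {M m i j : ℕ} (hi : i < M) (hj : j < M)
    (h : ((i : ℤ) - m) % M = ((j : ℤ) - m) % M) : i = j := by
  have h1 : (i : ℤ) ≡ j [ZMOD M] := by
    simpa using Int.ModEq.add_right (m : ℤ) (show (i : ℤ) - m ≡ j - m [ZMOD M] from h)
  exact Nat.ModEq.eq_of_lt_of_lt (Int.natCast_modEq_iff.mp h1) hi hj

theorem abs_cellSign_le_one (M m j : ℕ) : |cellSign M m j| ≤ 1 := by
  unfold cellSign
  split_ifs <;> simp

theorem sum_ite_emod_le_one (M m : ℕ) (r : ℤ) :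
    ∑ j ∈ Finset.range M, (if ((j : ℤ) - m) % M = r then (1 : ℝ) else 0) ≤ 1 := by
  rw [Finset.sum_boole]
  have : (Finset.filter (fun j : ℕ => ((j : ℤ) - m) % M = r) (Finset.range M)).card ≤ 1 := by
    rw [Finset.card_le_one]
    intro i hi j hj
    simp only [Finset.mem_filter, Finset.mem_range] at hi hj
    exact eq_of_sub_emod_eq hi.1 hj.1 (hi.2.trans hj.2.symm)
  exact_mod_cast this

theorem sum_abs_cellSign_le (M m : ℕ) : ∑ j ∈ Finset.range M, |cellSign M m j| ≤ 2 := by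
  calc ∑ j ∈ Finset.range M, |cellSign M m j|
      ≤ ∑ j ∈ Finset.range M, ((if ((j : ℤ) - m) % M = 0 then (1 : ℝ) else 0) +
          (if ((j : ℤ) - m) % M = M - 1 then (1 : ℝ) else 0)) := by
        refine Finset.sum_le_sum fun j _ => ?_
        unfold cellSign
        split_ifs <;> simp
    _ ≤ 2 := by
        rw [Finset.sum_add_distrib]
        linarith [sum_ite_emod_le_one M m 0, sum_ite_emod_le_one M m (M - 1)]

theorem integral_eq_sum_cells {M : ℕ} (hM : 2 ≤ M) {H : ℝ} (hH : H = 1 / M) {F g : ℝ → ℝ}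
    (hg : Continuous g) (c : ℕ → ℝ)
    (hF : ∀ j < M, ∀ x ∈ Set.Ico (j * H) ((j + 1) * H), F x = c j * g x) :
    ∫ x in (0 : ℝ)..1, F x =
      ∑ j ∈ Finset.range M, c j * ∫ x in (j * H)..((j + 1) * H), g x := by
  have hM0 : (0 : ℝ) < M := by positivity
  have hMH : M * H = 1 := by rw [hH]; field_simp
  have hH0 : 0 < H := by rw [hH]; positivity
  have hle : ∀ j : ℕ, (j : ℝ) * H ≤ (j + 1) * H := fun j => by nlinarith
  have hint : ∀ j < M, IntervalIntegrable F volume ((j : ℕ) * H) ((j + 1 : ℕ) * H) := by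
    intro j hj
    push_cast
    have h1 : IntervalIntegrable (fun x => c j * g x) volume (j * H) ((j + 1) * H) :=
      (hg.const_mul (c j)).intervalIntegrable _ _
    refine h1.congr_uIoo fun x hx => ?_
    rw [Set.uIoo_of_le (hle j)] at hx
    exact (hF j hj x ⟨hx.1.le, hx.2⟩).symm
  have h := sum_integral_adjacent_intervals (a := fun j : ℕ => (j : ℝ) * H) hint
  rw [Nat.cast_zero, zero_mul, hMH] at h
  rw [← h]
  refine Finset.sum_congr rfl fun j hj => ?_
  rw [← intervalIntegral.integral_const_mul]
  push_cast
  refine integral_congr_uIoo fun x hx => ?_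
  rw [Set.uIoo_of_le (hle j)] at hx
  exact hF j (Finset.mem_range.mp hj) x ⟨hx.1.le, hx.2⟩

theorem msCellR_eq {M : ℕ} (hM : 2 ≤ M) {H : ℝ} (hH : H = 1 / M) {a : ℝ → ℝ}
    (ha : Continuous fun x => (a x)⁻¹) {m j : ℕ} (hj : j < M)
    (hjm : ((j : ℤ) - m) % M = 0) :
    msCellR a H m = ∫ x in (j * H)..((j + 1) * H), (a x)⁻¹ := by
  unfold msCellR
  rw [integral_eq_sum_cells hM hH ha (fun i => if ((i : ℤ) - m) % M = 0 then 1 else 0)]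
  · rw [Finset.sum_eq_single_of_mem j (Finset.mem_range.mpr hj)]
    · simp [hjm]
    · intro i hi hij
      rw [if_neg, zero_mul]
      exact fun h => hij (eq_of_sub_emod_eq (Finset.mem_range.mp hi) hj (h.trans hjm.symm))
  · intro i _ x hx
    simp only [fract_sub_mul_lt_iff hM hH m i hx]
    split_ifs <;> simp

theorem msCellL_eq {M : ℕ} (hM : 2 ≤ M) {H : ℝ} (hH : H = 1 / M) {a : ℝ → ℝ}
    (ha : Continuous fun x => (a x)⁻¹) {m j : ℕ} (hj : j < M)
    (hjm : ((j : ℤ) - m) % M = M - 1) :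
    msCellL a H m = ∫ x in (j * H)..((j + 1) * H), (a x)⁻¹ := by
  unfold msCellL
  rw [integral_eq_sum_cells hM hH ha (fun i => if ((i : ℤ) - m) % M = M - 1 then 1 else 0)]
  · rw [Finset.sum_eq_single_of_mem j (Finset.mem_range.mpr hj)]
    · simp [hjm]
    · intro i hi hij
      rw [if_neg, zero_mul]
      exact fun h => hij (eq_of_sub_emod_eq (Finset.mem_range.mp hi) hj (h.trans hjm.symm))
  · intro i _ x hx
    simp only [one_sub_le_fract_sub_mul_iff hM hH m i hx]
    split_ifs <;> simp

theorem msPsi_eq {M : ℕ} (hM : 2 ≤ M) {H : ℝ} (hH : H = 1 / M) {a : ℝ → ℝ}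
    (ha : Continuous fun x => (a x)⁻¹) (m : ℕ) {j : ℕ} (hj : j < M) {x : ℝ}
    (hx : x ∈ Set.Ico (j * H) ((j + 1) * H)) :
    msPsi a H m x =
      cellSign M m j * ((a x)⁻¹ / ∫ x in (j * H)..((j + 1) * H), (a x)⁻¹) := by
  simp only [msPsi, cellSign, fract_sub_mul_lt_iff hM hH m j hx,
    one_sub_le_fract_sub_mul_iff hM hH m j hx]
  split_ifs with h1 h2
  · rw [msCellR_eq hM hH ha hj h1]; ring
  · rw [msCellL_eq hM hH ha hj h2]; ring
  · ring

theorem hatPsi_eq {M : ℕ} (hM : 2 ≤ M) {H : ℝ} (hH : H = 1 / M) (m j : ℕ) {x : ℝ}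
    (hx : x ∈ Set.Ico (j * H) ((j + 1) * H)) :
    hatPsi H m x = cellSign M m j / H := by
  simp only [hatPsi, cellSign, fract_sub_mul_lt_iff hM hH m j hx,
    one_sub_le_fract_sub_mul_iff hM hH m j hx]
  split_ifs <;> simp

/-- Over an interval of length `L`, the integral of a nonnegative `1`-periodic function differs
from `L` times its mean by at most the mean. -/
theorem abs_integral_periodic_sub_le {f : ℝ → ℝ} (hf : Continuous f)
    (hper : Function.Periodic f 1) (hnn : ∀ x, 0 ≤ f x) (u L : ℝ) :
    |(∫ x in u..(u + L), f x) - L * ∫ x in (0 : ℝ)..1, f x| ≤ ∫ x in (0 : ℝ)..1, f x := by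
  have hi : ∀ p q, IntervalIntegrable f volume p q := fun p q => hf.intervalIntegrable p q
  have hI : 0 ≤ ∫ x in (0 : ℝ)..1, f x := integral_nonneg zero_le_one fun x _ => hnn x
  have hfull : ∀ k : ℤ, ∫ x in u..(u + k), f x = k * ∫ x in (0 : ℝ)..1, f x := by
    intro k
    have h := hper.intervalIntegral_add_zsmul_eq k u hi
    have h' := hper.intervalIntegral_add_eq u 0
    rw [zero_add] at h'
    simpa [h'] using h
  have h1 := integral_add_adjacent_intervals (hi u (u + (⌊L⌋ : ℤ))) (hi (u + (⌊L⌋ : ℤ)) (u + L))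
  have h2 := integral_add_adjacent_intervals (hi u (u + L)) (hi (u + L) (u + ((⌊L⌋ + 1 : ℤ) : ℝ)))
  rw [hfull] at h1 h2
  have hfl := Int.floor_le L
  have hlt := Int.lt_floor_add_one L
  have h3 : 0 ≤ ∫ x in (u + (⌊L⌋ : ℤ))..(u + L), f x :=
    integral_nonneg (by linarith) fun x _ => hnn x
  have h4 : 0 ≤ ∫ x in (u + L)..(u + ((⌊L⌋ + 1 : ℤ) : ℝ)), f x :=
    integral_nonneg (by push_cast; linarith) fun x _ => hnn x
  push_cast at h2 h4
  rw [abs_le]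
  constructor <;> nlinarith

/-- The inverse of the integral of an oscillating inverse coefficient over a cell of size `H`
is close to the homogenized coefficient divided by `H`. -/
theorem abs_inv_cell_sub_le {lam Lam : ℝ} (hlam : 0 < lam) {A : ℝ → ℝ} (hA : Continuous A)
    (hper : ∀ y, A (y + 1) = A y) (hbd : ∀ y, lam ≤ A y ∧ A y ≤ Lam) {H δ : ℝ} (hH : 0 < H)
    (hδ : 0 < δ) (u : ℝ) :
    |(∫ x in u..(u + H), (A (x / δ))⁻¹)⁻¹ - (∫ y in (0 : ℝ)..1, (A y)⁻¹)⁻¹ / H| ≤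
      Lam * δ / H ^ 2 := by
  have hApos : ∀ y, 0 < A y := fun y => hlam.trans_le (hbd y).1
  have hLam : 0 < Lam := (hApos 0).trans_le (hbd 0).2
  have hc : Continuous fun y => (A y)⁻¹ := hA.inv₀ fun y => (hApos y).ne'
  have hc' : Continuous fun x => (A (x / δ))⁻¹ := hc.comp (continuous_id.div_const δ)
  have hlow : ∀ y, Lam⁻¹ ≤ (A y)⁻¹ := fun y => inv_anti₀ (hApos y) (hbd y).2
  have hP := abs_integral_periodic_sub_le hc (fun y => by simp only [hper])
    (fun y => (inv_pos.mpr (hApos y)).le) (u / δ) (H / δ)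
  have hsub : ∫ x in u..(u + H), (A (x / δ))⁻¹ =
      δ * ∫ y in (u / δ)..(u / δ + H / δ), (A y)⁻¹ := by
    rw [intervalIntegral.integral_comp_div (fun y => (A y)⁻¹) hδ.ne', smul_eq_mul, add_div]
  have hIlow : H * Lam⁻¹ ≤ ∫ x in u..(u + H), (A (x / δ))⁻¹ := by
    have := integral_mono_on (a := u) (b := u + H) (μ := volume) (f := fun _ => Lam⁻¹) (by linarith)
      (by simp) (hc'.intervalIntegrable _ _) fun x _ => hlow (x / δ)
    simpa using this
  have hJlow : Lam⁻¹ ≤ ∫ y in (0 : ℝ)..1, (A y)⁻¹ := by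
    have := integral_mono_on (a := 0) (b := 1) (μ := volume) (f := fun _ => Lam⁻¹) zero_le_one
      (by simp) (hc.intervalIntegrable _ _) fun x _ => hlow x
    simpa using this
  set I := ∫ x in u..(u + H), (A (x / δ))⁻¹
  set J := ∫ y in (0 : ℝ)..1, (A y)⁻¹
  have hJ : 0 < J := (inv_pos.mpr hLam).trans_le hJlow
  have hI : 0 < I := (mul_pos hH (inv_pos.mpr hLam)).trans_le hIlow
  have hIJ : |H * J - I| ≤ δ * J := by
    have : H * J - I = δ * -((∫ y in (u / δ)..(u / δ + H / δ), (A y)⁻¹) - H / δ * J) := by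
      rw [hsub]; field_simp; ring
    rw [this, abs_mul, abs_neg, abs_of_pos hδ]
    exact mul_le_mul_of_nonneg_left hP hδ.le
  have heq : I⁻¹ - J⁻¹ / H = (H * J - I) / (I * J * H) := by field_simp
  have hHI : H ≤ Lam * I := by
    have := mul_le_mul_of_nonneg_left hIlow hLam.le
    rwa [mul_left_comm, mul_inv_cancel₀ hLam.ne', mul_one] at this
  rw [heq, abs_div, abs_of_pos (by positivity : 0 < I * J * H), div_le_div_iff₀ (by positivity)
    (by positivity)]
  calc |H * J - I| * H ^ 2 ≤ δ * J * H ^ 2 := by gcongr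
    _ = δ * J * H * H := by ring
    _ ≤ δ * J * H * (Lam * I) := by gcongr
    _ = Lam * δ * (I * J * H) := by ring

/-- 1D convergence of the multiscale stiffness matrix to the homogenized
stiffness matrix at rate `O(δ/H²)`: with `a(x) = A(x/δ)`, `a_hom = (∫₀¹ A⁻¹)⁻¹`,
`𝔸_{nm} = -∫₀¹ a φ_m' φ_n'` and `𝔸hom_{nm} = -a_hom ∫₀¹ φ̄_m' φ̄_n'` (derivatives taken
piecewise), one has `|𝔸_{nm} - 𝔸hom_{nm}| ≤ C δ/H²` with `C` depending only on `λ, Λ`. -/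
theorem msfem_stiffness_convergence (lam Lam : ℝ) (hlam : 0 < lam) (hlamLam : lam ≤ Lam) :
    ∃ C > 0, ∀ M : ℕ, 2 ≤ M → ∀ A : ℝ → ℝ, Continuous A → (∀ y, A (y + 1) = A y) →
      (∀ y, lam ≤ A y ∧ A y ≤ Lam) → ∀ H δ : ℝ, H = 1 / M → 0 < δ → δ ≤ H →
      ∀ m n : ℕ,
        |(-∫ x in (0 : ℝ)..1, A (x / δ) *
              msPsi (fun t => A (t / δ)) H m x * msPsi (fun t => A (t / δ)) H n x) -
          (-(∫ y in (0 : ℝ)..1, (A y)⁻¹)⁻¹ *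
              ∫ x in (0 : ℝ)..1, hatPsi H m x * hatPsi H n x)| ≤ C * δ / H ^ 2 := by
  have hLam : 0 < Lam := hlam.trans_le hlamLam
  refine ⟨2 * Lam, by positivity, ?_⟩
  intro M hM A hA hper hbd H δ hH hδ _ m n
  have hH0 : 0 < H := by rw [hH]; positivity
  have hApos : ∀ y, 0 < A y := fun y => hlam.trans_le (hbd y).1
  have hc : Continuous fun x => (A (x / δ))⁻¹ :=
    (hA.inv₀ fun y => (hApos y).ne').comp (continuous_id.div_const δ)
  set I : ℕ → ℝ := fun j => ∫ x in (j * H)..((j + 1) * H), (A (x / δ))⁻¹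
  set J := ∫ y in (0 : ℝ)..1, (A y)⁻¹
  have hIpos : ∀ j, 0 < I j := fun j =>
    intervalIntegral_pos_of_pos (hc.intervalIntegrable _ _) (fun x => inv_pos.mpr (hApos _))
      (by nlinarith)
  have h1 : ∫ x in (0 : ℝ)..1, A (x / δ) *
      msPsi (fun t => A (t / δ)) H m x * msPsi (fun t => A (t / δ)) H n x =
      ∑ j ∈ Finset.range M, cellSign M m j * cellSign M n j * (I j)⁻¹ := by
    rw [integral_eq_sum_cells hM hH hc
      (fun j => cellSign M m j * cellSign M n j * ((I j)⁻¹ * (I j)⁻¹))]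
    · refine Finset.sum_congr rfl fun j _ => ?_
      have := (hIpos j).ne'
      change _ * I j = _
      field_simp
    · intro j hj x hx
      rw [msPsi_eq hM hH hc m hj hx, msPsi_eq hM hH hc n hj hx]
      change A (x / δ) * (_ * ((A (x / δ))⁻¹ / I j)) * (_ * ((A (x / δ))⁻¹ / I j)) = _
      have := (hIpos j).ne'
      have := (hApos (x / δ)).ne'
      field_simp
  have h2 : ∫ x in (0 : ℝ)..1, hatPsi H m x * hatPsi H n x =
      ∑ j ∈ Finset.range M, cellSign M m j * cellSign M n j * H⁻¹ := by
    rw [integral_eq_sum_cells hM hH (g := fun _ => 1) continuous_const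
      (fun j => cellSign M m j * cellSign M n j * (H⁻¹ * H⁻¹))]
    · refine Finset.sum_congr rfl fun j _ => ?_
      rw [intervalIntegral.integral_const, smul_eq_mul]
      field_simp
      ring
    · intro j _ x hx
      rw [hatPsi_eq hM hH m j hx, hatPsi_eq hM hH n j hx]
      ring
  have hcell : ∀ j, |(I j)⁻¹ - J⁻¹ / H| ≤ Lam * δ / H ^ 2 := fun j => by
    have h := abs_inv_cell_sub_le hlam hA hper hbd hH0 hδ (j * H)
    rwa [show (j : ℝ) * H + H = (j + 1) * H by ring] at h
  have hdiff : -(∑ j ∈ Finset.range M, cellSign M m j * cellSign M n j * (I j)⁻¹) -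
      (-J⁻¹ * ∑ j ∈ Finset.range M, cellSign M m j * cellSign M n j * H⁻¹) =
      -∑ j ∈ Finset.range M, cellSign M m j * cellSign M n j * ((I j)⁻¹ - J⁻¹ / H) := by
    simp only [mul_sub, Finset.sum_sub_distrib, Finset.mul_sum, neg_mul, Finset.sum_neg_distrib]
    rw [neg_sub, sub_neg_eq_add, neg_add_eq_sub]
    congr 1
    exact Finset.sum_congr rfl fun j _ => by ring
  rw [h1, h2, hdiff, abs_neg]
  calc |∑ j ∈ Finset.range M, cellSign M m j * cellSign M n j * ((I j)⁻¹ - J⁻¹ / H)|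
      ≤ ∑ j ∈ Finset.range M, |cellSign M m j| * (Lam * δ / H ^ 2) := by
        refine (Finset.abs_sum_le_sum_abs _ _).trans (Finset.sum_le_sum fun j _ => ?_)
        rw [abs_mul, abs_mul]
        exact mul_le_mul (mul_le_of_le_one_right (abs_nonneg _) (abs_cellSign_le_one M n j))
          (hcell j) (abs_nonneg _) (abs_nonneg _)
    _ = (∑ j ∈ Finset.range M, |cellSign M m j|) * (Lam * δ / H ^ 2) := by
        rw [Finset.sum_mul]
    _ ≤ 2 * (Lam * δ / H ^ 2) := by
        gcongr
        exact sum_abs_cellSign_le M m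
    _ = 2 * Lam * δ / H ^ 2 := by ring
end
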